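/- arXiv:2102.12412 — 12 statements merged into one kernel-verified Lean document; each statement's English description precedes it below -/
import Mathlib

section
/- Consider a non-adaptive composition of k independent discrete mechanisms: for each ℓ = 1,…,k, let p_ℓ and q_ℓ be probability mass functions on a finite type R_ℓ (the output distributions of mechanism ℓ on neighbouring datasets X and Y), and let P = p_1 ⊗ ⋯ ⊗ p_k and Q = q_1 ⊗ ⋯ ⊗ q_k be the corresponding product probability mass functions on R_1 × ⋯ × R_k. Define δ_{∞,ℓ} = Σ_{t : p_ℓ(t) > 0 and q_ℓ(t) = 0} p_ℓ(t), and for ε > 0 define δ_{X/Y}(ε) = 1 − ∏_{ℓ=1}^k (1 − δ_{∞,ℓ}) + Σ over tuples t = (t_1,…,t_k) with p_ℓ(t_ℓ) > 0 and q_ℓ(t_ℓ) > 0 for all ℓ and Σ_ℓ log(p_ℓ(t_ℓ)/q_ℓ(t_ℓ)) ≥ ε of ∏_ℓ p_ℓ(t_ℓ) · (1 − e^{ε − Σ_ℓ log(p_ℓ(t_ℓ)/q_ℓ(t_ℓ))}); define δ_{Y/X}(ε) symmetrically with the roles of p and q exchanged. Then the composition is tightly (ε,δ)-DP for δ(ε)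 = max{δ_{X/Y}(ε), δ_{Y/X}(ε)}: (i) for every subset E of R_1 × ⋯ × R_k one has P(E) ≤ e^ε Q(E) + δ(ε) and Q(E) ≤ e^ε P(E) + δ(ε); and (ii) there is no δ' < δ(ε) for which (i) holds with δ(ε) replaced by δ'. -/
open scoped Classical
open Finset

/-- The pointwise identity behind the hockey-stick form of the privacy loss sum: splitting off the
outcomes that are impossible under `v`, the remaining mass contributes `(∏ u - e ^ ε ∏ v)⁺`. -/
lemma prod_sub_prod_ite_add_ite_log_eq_max {k : ℕ} {u v : Fin k → ℝ}
    (hu : ∀ i, 0 ≤ u i) (hv : ∀ i, 0 ≤ v i) (ε : ℝ) :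
    (∏ i, u i) - (∏ i, if 0 < u i ∧ v i = 0 then 0 else u i) +
      (if (∀ i, 0 < u i ∧ 0 < v i) ∧ ε ≤ ∑ i, Real.log (u i / v i) then
        (∏ i, u i) * (1 - Real.exp (ε - ∑ i, Real.log (u i / v i))) else 0) =
      max 0 ((∏ i, u i) - Real.exp ε * ∏ i, v i) := by
  have hV : 0 ≤ ∏ i, v i := prod_nonneg fun i _ => hv i
  by_cases hall : ∀ i, 0 < u i ∧ 0 < v i
  · have hU : 0 < ∏ i, u i := prod_pos fun i _ => (hall i).1
    have hV : 0 < ∏ i, v i := prod_pos fun i _ => (hall i).2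
    have hlog : ∑ i, Real.log (u i / v i) = Real.log ((∏ i, u i) / ∏ i, v i) := by
      rw [← prod_div_distrib,
        Real.log_prod fun i _ => (div_pos (hall i).1 (hall i).2).ne']
    have hite : (∏ i, if 0 < u i ∧ v i = 0 then 0 else u i) = ∏ i, u i :=
      prod_congr rfl fun i _ => if_neg fun h => (hall i).2.ne' h.2
    have hiff : ε ≤ Real.log ((∏ i, u i) / ∏ i, v i) ↔ Real.exp ε * ∏ i, v i ≤ ∏ i, u i := by
      rw [Real.le_log_iff_exp_le (div_pos hU hV), le_div_iff₀ hV]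
    rw [hite, hlog, sub_self, zero_add]
    by_cases h : Real.exp ε * ∏ i, v i ≤ ∏ i, u i
    · rw [if_pos ⟨hall, hiff.2 h⟩, max_eq_right (sub_nonneg.2 h), Real.exp_sub,
        Real.exp_log (div_pos hU hV)]
      field_simp
    · rw [if_neg fun h' => h (hiff.1 h'.2), max_eq_left (sub_nonpos.2 (not_le.1 h).le)]
  · rw [if_neg fun h => hall h.1, add_zero]
    by_cases hu0 : ∃ i, u i = 0
    · obtain ⟨i, hi⟩ := hu0
      have hU : ∏ i, u i = 0 := prod_eq_zero (mem_univ i) hi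
      have hite : (∏ i, if 0 < u i ∧ v i = 0 then 0 else u i) = 0 :=
        prod_eq_zero (mem_univ i) (by simp [hi])
      rw [hU, hite, sub_zero, zero_sub, max_eq_left]
      exact neg_nonpos.2 (mul_nonneg (Real.exp_pos ε).le hV)
    · have hupos : ∀ i, 0 < u i := fun i => (hu i).lt_of_ne' fun h => hu0 ⟨i, h⟩
      obtain ⟨i, hi⟩ : ∃ i, v i = 0 := by
        by_contra! h
        exact hall fun i => ⟨hupos i, (hv i).lt_of_ne' (h i)⟩
      have hite : (∏ i, if 0 < u i ∧ v i = 0 then 0 else u i) = 0 :=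
        prod_eq_zero (mem_univ i) (if_pos ⟨hupos i, hi⟩)
      rw [hite, prod_eq_zero (mem_univ i) hi, sub_zero, mul_zero, sub_zero,
        max_eq_right (prod_nonneg fun i _ => hu i)]

/-- The one-sided privacy loss expression of a composition is the hockey-stick divergence of the
product distributions. -/
lemma one_sub_prod_add_sum_log_eq_sum_max {k : ℕ} {R : Fin k → Type*}
    [∀ i, Fintype (R i)] {u v : ∀ i, R i → ℝ} (hu : ∀ i t, 0 ≤ u i t) (hv : ∀ i t, 0 ≤ v i t)
    (hu1 : ∀ i, ∑ t, u i t = 1) (ε : ℝ) :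
    1 - ∏ i, (1 - ∑ t, if 0 < u i t ∧ v i t = 0 then u i t else 0) +
      ∑ t : ∀ i, R i,
        (if (∀ i, 0 < u i (t i) ∧ 0 < v i (t i)) ∧ ε ≤ ∑ i, Real.log (u i (t i) / v i (t i)) then
          (∏ i, u i (t i)) * (1 - Real.exp (ε - ∑ i, Real.log (u i (t i) / v i (t i)))) else 0) =
      ∑ t : ∀ i, R i, max 0 ((∏ i, u i (t i)) - Real.exp ε * ∏ i, v i (t i)) := by
  have htotal : (1 : ℝ) = ∑ t : ∀ i, R i, ∏ i, u i (t i) := by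
    rw [← Fintype.prod_sum, prod_congr rfl fun i _ => hu1 i, prod_const_one]
  have hfin : ∏ i, (1 - ∑ t, if 0 < u i t ∧ v i t = 0 then u i t else 0) =
      ∑ t : ∀ i, R i, ∏ i, if 0 < u i (t i) ∧ v i (t i) = 0 then 0 else u i (t i) := by
    rw [← Fintype.prod_sum fun i t => if 0 < u i t ∧ v i t = 0 then 0 else u i t]
    refine prod_congr rfl fun i _ => ?_
    rw [← hu1 i, ← sum_sub_distrib]
    refine sum_congr rfl fun t _ => ?_
    split_ifs <;> ring
  rw [hfin]
  nth_rewrite 1 [htotal]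
  rw [← sum_sub_distrib, ← sum_add_distrib]
  exact sum_congr rfl fun t _ =>
    prod_sub_prod_ite_add_ite_log_eq_max (fun i => hu i (t i)) (fun i => hv i (t i)) ε

/-- The hockey-stick divergence bounds the excess of `f` over `c * g` on every event. -/
lemma sum_le_mul_sum_add_sum_max {α : Type*} [Fintype α] (f g : α → ℝ) (c : ℝ) (E : Finset α) :
    ∑ t ∈ E, f t ≤ c * ∑ t ∈ E, g t + ∑ t, max 0 (f t - c * g t) := by
  rw [← sub_le_iff_le_add', mul_sum, ← sum_sub_distrib]
  exact (sum_le_sum fun t _ => le_max_right _ _).trans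
    (sum_le_univ_sum_of_nonneg fun t => le_max_left _ _)

/-- The hockey-stick divergence is the least upper bound of the excess of `f` over `c * g`. -/
lemma sum_max_le_of_forall_sum_le {α : Type*} [Fintype α] {f g : α → ℝ} {c d : ℝ}
    (h : ∀ E : Finset α, ∑ t ∈ E, f t ≤ c * ∑ t ∈ E, g t + d) :
    ∑ t, max 0 (f t - c * g t) ≤ d := by
  have hE := h {t | 0 ≤ f t - c * g t}
  rw [← sub_le_iff_le_add', mul_sum, ← sum_sub_distrib, sum_filter] at hE
  refine (sum_congr rfl fun t _ => ?_).trans_le hE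
  split_ifs with ht
  · exact max_eq_right ht
  · exact max_eq_left (not_le.1 ht).le

/-- The larger of the two hockey-stick divergences is the least `d` for which `f` and `g` are
indistinguishable with multiplicative slack `c` and additive slack `d`. -/
lemma forall_le_and_not_exists_lt_max_sum_max {α : Type*} [Fintype α] (f g : α → ℝ) (c : ℝ) :
    (∀ E : Finset α,
      ∑ t ∈ E, f t ≤ c * ∑ t ∈ E, g t +
        max (∑ t, max 0 (f t - c * g t)) (∑ t, max 0 (g t - c * f t)) ∧
      ∑ t ∈ E, g t ≤ c * ∑ t ∈ E, f t +
        max (∑ t, max 0 (f t - c * g t)) (∑ t, max 0 (g t - c * f t))) ∧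
    ¬ ∃ d, d < max (∑ t, max 0 (f t - c * g t)) (∑ t, max 0 (g t - c * f t)) ∧
      ∀ E : Finset α, ∑ t ∈ E, f t ≤ c * ∑ t ∈ E, g t + d ∧
        ∑ t ∈ E, g t ≤ c * ∑ t ∈ E, f t + d := by
  refine ⟨fun E => ⟨?_, ?_⟩, ?_⟩
  · grw [sum_le_mul_sum_add_sum_max f g c E, ← le_max_left]
  · grw [sum_le_mul_sum_add_sum_max g f c E, ← le_max_right]
  · rintro ⟨d, hlt, h⟩
    exact hlt.not_ge (max_le (sum_max_le_of_forall_sum_le fun E => (h E).1)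
      (sum_max_le_of_forall_sum_le fun E => (h E).2))

/-- Theorem 4 (tight (ε,δ)-bounds for non-adaptive compositions of discrete
mechanisms via convolutions of privacy loss distributions). -/
theorem tight_DP_heterogeneous_composition
    {k : ℕ} (R : Fin k → Type*) [∀ ℓ, Fintype (R ℓ)]
    (p q : ∀ ℓ, R ℓ → ℝ)
    (hp0 : ∀ ℓ t, 0 ≤ p ℓ t) (hq0 : ∀ ℓ t, 0 ≤ q ℓ t)
    (hp1 : ∀ ℓ, ∑ t, p ℓ t = 1) (hq1 : ∀ ℓ, ∑ t, q ℓ t = 1)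
    (ε : ℝ) (hε : 0 < ε) :
    -- δ_{∞,ℓ} for a pair of families of pmfs
    let δinf : (∀ ℓ, R ℓ → ℝ) → (∀ ℓ, R ℓ → ℝ) → Fin k → ℝ := fun u v ℓ =>
      ∑ t, if 0 < u ℓ t ∧ v ℓ t = 0 then u ℓ t else 0
    -- δ_{X/Y}(ε) (one-sided δ)
    let δone : (∀ ℓ, R ℓ → ℝ) → (∀ ℓ, R ℓ → ℝ) → ℝ := fun u v =>
      1 - ∏ ℓ, (1 - δinf u v ℓ) +
        ∑ t : ∀ ℓ, R ℓ,
          if (∀ ℓ, 0 < u ℓ (t ℓ) ∧ 0 < v ℓ (t ℓ)) ∧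
              ε ≤ ∑ ℓ, Real.log (u ℓ (t ℓ) / v ℓ (t ℓ)) then
            (∏ ℓ, u ℓ (t ℓ)) *
              (1 - Real.exp (ε - ∑ ℓ, Real.log (u ℓ (t ℓ) / v ℓ (t ℓ))))
          else 0
    let δ : ℝ := max (δone p q) (δone q p)
    -- product measures of the composed mechanisms
    let P : Finset (∀ ℓ, R ℓ) → ℝ := fun E => ∑ t ∈ E, ∏ ℓ, p ℓ (t ℓ)
    let Q : Finset (∀ ℓ, R ℓ) → ℝ := fun E => ∑ t ∈ E, ∏ ℓ, q ℓ (t ℓ)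
    -- (i) the composition is (ε, δ(ε))-DP, and (ii) tightly so
    (∀ E : Finset (∀ ℓ, R ℓ),
        P E ≤ Real.exp ε * Q E + δ ∧ Q E ≤ Real.exp ε * P E + δ) ∧
    ¬ ∃ δ' : ℝ, δ' < δ ∧ ∀ E : Finset (∀ ℓ, R ℓ),
        P E ≤ Real.exp ε * Q E + δ' ∧ Q E ≤ Real.exp ε * P E + δ' := by
  intro δinf δone δ P Q
  have hpq : δone p q = ∑ t : ∀ ℓ, R ℓ, max 0 ((∏ ℓ, p ℓ (t ℓ)) - Real.exp ε * ∏ ℓ, q ℓ (t ℓ)) :=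
    one_sub_prod_add_sum_log_eq_sum_max hp0 hq0 hp1 ε
  have hqp : δone q p = ∑ t : ∀ ℓ, R ℓ, max 0 ((∏ ℓ, q ℓ (t ℓ)) - Real.exp ε * ∏ ℓ, p ℓ (t ℓ)) :=
    one_sub_prod_add_sum_log_eq_sum_max hq0 hp0 hq1 ε
  have hδ := congrArg₂ max hpq hqp
  change δ = _ at hδ
  clear_value δ
  subst hδ
  exact forall_le_and_not_exists_lt_max_sum_max
    (fun t : ∀ ℓ, R ℓ => ∏ ℓ, p ℓ (t ℓ)) (fun t : ∀ ℓ, R ℓ => ∏ ℓ, q ℓ (t ℓ))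
    (Real.exp ε)
end

section
/- Let μ be a σ-finite measure on ℝ^d (e.g. Lebesgue measure), and let f_X and f_{X'} be nonnegative measurable functions with ∫ f_X dμ = ∫ f_{X'} dμ = 1, defining probability measures P = f_X·μ and Q = f_{X'}·μ. Then for every ε > 0 and δ ∈ [0,1], P and Q are (ε,δ)-indistinguishable if and only if δ ≥ max{ ∫_{ℝ^d} max(f_X(t) − e^ε f_{X'}(t), 0) dμ(t), ∫_{ℝ^d} max(f_{X'}(t) − e^ε f_X(t), 0) dμ(t) }. In particular, P and Q are tightly (ε,δ)-indistinguishable with δ(ε) equal to this maximum. -/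
open MeasureTheory

/-- The integral of the positive part of `h` is the largest integral of `h` over a measurable set. -/
theorem forall_setIntegral_le_iff_integral_max_zero_le {α : Type*} [MeasurableSpace α]
    {μ : Measure α} {h : α → ℝ} (hm : Measurable h) (hi : Integrable h μ) (δ : ℝ) :
    (∀ E, MeasurableSet E → ∫ t in E, h t ∂μ ≤ δ) ↔ ∫ t, max (h t) 0 ∂μ ≤ δ := by
  constructor
  · intro H
    have hE : MeasurableSet {t | 0 ≤ h t} := measurableSet_le measurable_const hm
    convert H _ hE using 1
    rw [← integral_indicator hE]
    congr 1 with t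
    by_cases ht : 0 ≤ h t
    · simp [ht]
    · simp [ht, le_of_not_ge ht]
  · intro H E hE
    calc ∫ t in E, h t ∂μ ≤ ∫ t in E, max (h t) 0 ∂μ :=
          setIntegral_mono hi.integrableOn hi.pos_part.integrableOn fun t => le_max_left _ _
      _ ≤ ∫ t, max (h t) 0 ∂μ :=
          setIntegral_le_integral hi.pos_part (ae_of_all _ fun t => le_max_right _ _)
      _ ≤ δ := H

theorem withDensity_ofReal_apply_eq_ofReal_setIntegral {α : Type*} [MeasurableSpace α]
    {μ : Measure α} {f : α → ℝ} (hi : Integrable f μ) (h0 : ∀ t, 0 ≤ f t)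
    {E : Set α} (hE : MeasurableSet E) :
    μ.withDensity (fun t => ENNReal.ofReal (f t)) E = ENNReal.ofReal (∫ t in E, f t ∂μ) := by
  rw [withDensity_apply _ hE, ofReal_integral_eq_lintegral_ofReal hi.integrableOn (ae_of_all _ h0)]

theorem withDensity_le_mul_add_iff_integral_max_le {α : Type*} [MeasurableSpace α]
    {μ : Measure α} {f g : α → ℝ} (hmf : Measurable f) (hmg : Measurable g)
    (hif : Integrable f μ) (hig : Integrable g μ) (h0f : ∀ t, 0 ≤ f t) (h0g : ∀ t, 0 ≤ g t)
    {c δ : ℝ} (hc : 0 ≤ c) (hδ : 0 ≤ δ) :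
    (∀ E, MeasurableSet E → μ.withDensity (fun t => ENNReal.ofReal (f t)) E ≤
      ENNReal.ofReal c * μ.withDensity (fun t => ENNReal.ofReal (g t)) E + ENNReal.ofReal δ) ↔
    ∫ t, max (f t - c * g t) 0 ∂μ ≤ δ := by
  rw [← forall_setIntegral_le_iff_integral_max_zero_le (h := fun t => f t - c * g t)
    (hmf.sub (hmg.const_mul c)) (hif.sub (hig.const_mul c))]
  refine forall₂_congr fun E hE => ?_
  have hgE : 0 ≤ ∫ t in E, g t ∂μ := integral_nonneg h0g
  rw [withDensity_ofReal_apply_eq_ofReal_setIntegral hif h0f hE,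
    withDensity_ofReal_apply_eq_ofReal_setIntegral hig h0g hE, ← ENNReal.ofReal_mul hc,
    ← ENNReal.ofReal_add (mul_nonneg hc hgE) hδ,
    ENNReal.ofReal_le_ofReal_iff (add_nonneg (mul_nonneg hc hgE) hδ),
    integral_sub hif.integrableOn (hig.const_mul c).integrableOn, integral_const_mul,
    sub_le_iff_le_add']

/-- Lemma D: hockey-stick characterisation of the tight δ(ε) for a pair of
probability densities with respect to a σ-finite measure on ℝ^d. -/
theorem tight_delta_hockey_stick
    {d : ℕ} (μ : Measure (Fin d → ℝ)) [SigmaFinite μ]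
    (fX fX' : (Fin d → ℝ) → ℝ)
    (hmX : Measurable fX) (hmX' : Measurable fX')
    (h0X : ∀ t, 0 ≤ fX t) (h0X' : ∀ t, 0 ≤ fX' t)
    (h1X : ∫ t, fX t ∂μ = 1) (h1X' : ∫ t, fX' t ∂μ = 1)
    (ε : ℝ) (hε : 0 < ε) (δ : ℝ) (hδ : δ ∈ Set.Icc (0 : ℝ) 1) :
    let P : Measure (Fin d → ℝ) := μ.withDensity fun t => ENNReal.ofReal (fX t)
    let Q : Measure (Fin d → ℝ) := μ.withDensity fun t => ENNReal.ofReal (fX' t)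
    -- (ε, δ')-indistinguishability of P and Q
    let Ind : ℝ → Prop := fun δ' =>
      ∀ E : Set (Fin d → ℝ), MeasurableSet E →
        P E ≤ ENNReal.ofReal (Real.exp ε) * Q E + ENNReal.ofReal δ' ∧
        Q E ≤ ENNReal.ofReal (Real.exp ε) * P E + ENNReal.ofReal δ'
    let δstar : ℝ := max (∫ t, max (fX t - Real.exp ε * fX' t) 0 ∂μ)
                         (∫ t, max (fX' t - Real.exp ε * fX t) 0 ∂μ)
    -- P and Q are (ε,δ)-indistinguishable iff δ ≥ δstar; in particular, they
    -- are tightly (ε, δstar)-indistinguishable.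
    (Ind δ ↔ δstar ≤ δ) ∧
    (Ind δstar ∧ ∀ δ' : ℝ, 0 ≤ δ' → δ' < δstar → ¬ Ind δ') := by
  intro P Q Ind δstar
  have hi : Integrable fX μ := .of_integral_ne_zero (by simp [h1X])
  have hi' : Integrable fX' μ := .of_integral_ne_zero (by simp [h1X'])
  have key : ∀ δ' : ℝ, 0 ≤ δ' → (Ind δ' ↔ δstar ≤ δ') := fun δ' hδ' => by
    rw [max_le_iff,
      ← withDensity_le_mul_add_iff_integral_max_le hmX hmX' hi hi' h0X h0X' (Real.exp_nonneg ε) hδ',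
      ← withDensity_le_mul_add_iff_integral_max_le hmX' hmX hi' hi h0X' h0X (Real.exp_nonneg ε) hδ']
    simp only [Ind, forall_and, P, Q]
  have hstar : 0 ≤ δstar := le_max_of_le_left (integral_nonneg fun t => le_max_right _ _)
  exact ⟨key δ hδ.1, (key δstar hstar).2 le_rfl,
    fun δ' h0 hlt hInd => hlt.not_ge ((key δ' h0).1 hInd)⟩
end

section
/- Let μ be a σ-finite measure on ℝ^d and let f_X, f_{X'} be nonnegative measurable probability densities with respect to μ (∫ f_X dμ = ∫ f_{X'} dμ = 1), and assume μ({t : f_X(t) > 0 and f_{X'}(t) = 0}) = 0. Define the privacy loss distribution ω_{X/X'} as the pushforward of the measure f_X·μ under the privacy loss function L(t) = log(f_X(t)/f_{X'}(t)) (defined on the set where f_X > 0). Then for every ε > 0, ∫_{ℝ^d} max(f_X(t) − e^ε f_{X'}(t), 0) dμ(t) = ∫_ℝ max(1 − e^{ε−s}, 0) dω_{X/X'}(s). Consequently, if additionally μ({t : f_{X'}(t) > 0 and f_X(t) = 0}) = 0, the tight δ as a function of ε is δ(ε) = max{ E_{s∼ω_{X/X'}}[(1 − e^{ε−s})_+],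 E_{s∼ω_{X'/X}}[(1 − e^{ε−s})_+] }. -/
open MeasureTheory

/-- The hockey-stick divergence of two densities as an expectation over the pushforward of the
first density under the log-likelihood ratio. -/
theorem integral_max_sub_exp_mul_eq_integral_map_log_div {α : Type*} [MeasurableSpace α]
    {μ : Measure α} {f g : α → ℝ} (hf : Measurable f) (hg : Measurable g)
    (hf0 : ∀ t, 0 ≤ f t) (hg0 : ∀ t, 0 ≤ g t) (habs : μ {t | 0 < f t ∧ g t = 0} = 0) (ε : ℝ) :
    ∫ t, max (f t - Real.exp ε * g t) 0 ∂μ =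
      ∫ s, max (1 - Real.exp (ε - s)) 0 ∂(Measure.map (fun t => Real.log (f t / g t))
        (μ.withDensity fun t => ENNReal.ofReal (f t))) := by
  rw [integral_map (by fun_prop) (by fun_prop),
    integral_withDensity_eq_integral_toReal_smul (by fun_prop) (by simp)]
  have hae : ∀ᵐ t ∂μ, ¬ (0 < f t ∧ g t = 0) := measure_eq_zero_iff_ae_notMem.mp habs
  refine integral_congr_ae ?_
  filter_upwards [hae] with t ht
  rw [ENNReal.toReal_ofReal (hf0 t), smul_eq_mul]
  rcases (hf0 t).eq_or_lt with h | hft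
  · have := mul_nonneg (Real.exp_pos ε).le (hg0 t)
    rw [← h, zero_mul, max_eq_right (by linarith)]
  · have hgt : 0 < g t := (hg0 t).lt_of_ne fun h => ht ⟨hft, h.symm⟩
    rw [Real.exp_sub, Real.exp_log (div_pos hft hgt), mul_max_of_nonneg _ _ hft.le]
    rw [mul_zero]
    congr 1
    field_simp

/-- The tight δ(ε) expressed as an expectation over the privacy loss
distribution (appendix lemma: change of variables `s = log(f_X/f_X')`). -/
theorem tight_delta_as_pld_expectation
    {d : ℕ} (μ : Measure (Fin d → ℝ)) [SigmaFinite μ]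
    (fX fX' : (Fin d → ℝ) → ℝ)
    (hmX : Measurable fX) (hmX' : Measurable fX')
    (h0X : ∀ t, 0 ≤ fX t) (h0X' : ∀ t, 0 ≤ fX' t)
    (h1X : ∫ t, fX t ∂μ = 1) (h1X' : ∫ t, fX' t ∂μ = 1)
    (habs : μ {t | 0 < fX t ∧ fX' t = 0} = 0)
    (ε : ℝ) (hε : 0 < ε) :
    -- the privacy loss distribution of a pair of densities (f, g):
    -- pushforward of f·μ under t ↦ log(f t / g t)
    let pld : ((Fin d → ℝ) → ℝ) → ((Fin d → ℝ) → ℝ) → Measure ℝ := fun f g =>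
      Measure.map (fun t => Real.log (f t / g t))
        (μ.withDensity fun t => ENNReal.ofReal (f t))
    (∫ t, max (fX t - Real.exp ε * fX' t) 0 ∂μ =
        ∫ s, max (1 - Real.exp (ε - s)) 0 ∂(pld fX fX')) ∧
    (μ {t | 0 < fX' t ∧ fX t = 0} = 0 →
      max (∫ t, max (fX t - Real.exp ε * fX' t) 0 ∂μ)
          (∫ t, max (fX' t - Real.exp ε * fX t) 0 ∂μ) =
      max (∫ s, max (1 - Real.exp (ε - s)) 0 ∂(pld fX fX'))
          (∫ s, max (1 - Real.exp (ε - s)) 0 ∂(pld fX' fX))) := by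
  intro pld
  have h := integral_max_sub_exp_mul_eq_integral_map_log_div hmX hmX' h0X h0X' habs ε
  refine ⟨h, fun habs' => ?_⟩
  rw [h, integral_max_sub_exp_mul_eq_integral_map_log_div hmX' hmX h0X' h0X habs' ε]
end

section
/- Let L > 0, n a positive integer, Δx = 2L/n, and let X_n = {−L + i·Δx : 0 ≤ i ≤ n−1} be the equidistant grid. For ℓ = 1,…,k, let ω_ℓ be a discrete distribution given by finitely many weights a_i^ℓ ≥ 0 placed at points s_i^ℓ ∈ [−L, L − Δx], and define its left and right grid approximations by moving each point s_i^ℓ to s_i^{L,ℓ} = max{x ∈ X_n : x ≤ s_i^ℓ} and s_i^{R,ℓ} = min{x ∈ X_n : x ≥ s_i^ℓ} respectively (the weights are unchanged). For ε > 0 define δ(ε) = Σ over index tuples (i_1,…,i_k) of (∏_{ℓ=1}^k a_{i_ℓ}^ℓ) · max(1 − e^{ε − (s_{i_1}^1 + ⋯ + s_{i_k}^k)}, 0), and define δ^L(ε) and δ^R(ε) by the same formula with the points s replaced by their left, respectively right, grid projections. Then for all ε > 0, δ^L(ε) ≤ δ(ε) ≤ δ^R(ε). -/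
open Finset

/-- The `δ(ε)`-functional of a convolution is monotone in the positions of the atoms. -/
theorem sum_prod_mul_max_one_sub_exp_mono {κ : Type*} [Fintype κ] [DecidableEq κ]
    {ι : κ → Type*} [∀ ℓ, Fintype (ι ℓ)] {a p q : ∀ ℓ, ι ℓ → ℝ} (ha : ∀ ℓ i, 0 ≤ a ℓ i)
    (h : ∀ ℓ i, p ℓ i ≤ q ℓ i) (ε : ℝ) :
    ∑ t : ∀ ℓ, ι ℓ, (∏ ℓ, a ℓ (t ℓ)) * max (1 - Real.exp (ε - ∑ ℓ, p ℓ (t ℓ))) 0 ≤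
      ∑ t : ∀ ℓ, ι ℓ, (∏ ℓ, a ℓ (t ℓ)) * max (1 - Real.exp (ε - ∑ ℓ, q ℓ (t ℓ))) 0 := by
  refine Finset.sum_le_sum fun t _ => mul_le_mul_of_nonneg_left ?_
    (Finset.prod_nonneg fun ℓ _ => ha ℓ (t ℓ))
  have hsum : ∑ ℓ, p ℓ (t ℓ) ≤ ∑ ℓ, q ℓ (t ℓ) := Finset.sum_le_sum fun ℓ _ => h ℓ (t ℓ)
  gcongr

theorem neg_add_mul_floor_le {d : ℝ} (hd : 0 < d) (L x : ℝ) :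
    -L + d * (⌊(x + L) / d⌋ : ℝ) ≤ x := by
  have h := (le_div_iff₀' hd).mp (Int.floor_le ((x + L) / d))
  linarith

theorem le_neg_add_mul_ceil {d : ℝ} (hd : 0 < d) (L x : ℝ) :
    x ≤ -L + d * (⌈(x + L) / d⌉ : ℝ) := by
  have h := (div_le_iff₀' hd).mp (Int.le_ceil ((x + L) / d))
  linarith

/-- Lemma 5: the left and right grid approximations sandwich the true δ(ε).
For `x ∈ [-L, L - Δx]`, `-L + Δx·⌊(x+L)/Δx⌋` is the largest grid point
`≤ x` and `-L + Δx·⌈(x+L)/Δx⌉` the smallest grid point `≥ x` of the grid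
`X_n = {-L + iΔx : 0 ≤ i ≤ n-1}`, `Δx = 2L/n`. -/
theorem grid_approximation_sandwich
    {k : ℕ} (ι : Fin k → Type*) [∀ ℓ, Fintype (ι ℓ)]
    (L : ℝ) (hL : 0 < L) (n : ℕ) (hn : 0 < n)
    (a : ∀ ℓ, ι ℓ → ℝ) (s : ∀ ℓ, ι ℓ → ℝ)
    (ha : ∀ ℓ i, 0 ≤ a ℓ i)
    (hs : ∀ ℓ i, -L ≤ s ℓ i ∧ s ℓ i ≤ L - 2 * L / n)
    (ε : ℝ) (hε : 0 < ε) :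
    let Δx : ℝ := 2 * L / n
    -- left and right grid projections
    let projL : ℝ → ℝ := fun x => -L + Δx * (⌊(x + L) / Δx⌋ : ℝ)
    let projR : ℝ → ℝ := fun x => -L + Δx * (⌈(x + L) / Δx⌉ : ℝ)
    -- δ(ε)-functional of the convolution of the k discrete distributions
    -- whose atoms sit at the points `pts`
    let δ : (∀ ℓ, ι ℓ → ℝ) → ℝ := fun pts =>
      ∑ t : ∀ ℓ, ι ℓ,
        (∏ ℓ, a ℓ (t ℓ)) * max (1 - Real.exp (ε - ∑ ℓ, pts ℓ (t ℓ))) 0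
    δ (fun ℓ i => projL (s ℓ i)) ≤ δ s ∧ δ s ≤ δ (fun ℓ i => projR (s ℓ i)) := by
  intro Δx projL projR δ
  have hΔ : 0 < Δx := by positivity
  exact ⟨sum_prod_mul_max_one_sub_exp_mono ha (fun ℓ i => neg_add_mul_floor_le hΔ L (s ℓ i)) ε,
    sum_prod_mul_max_one_sub_exp_mono ha (fun ℓ i => le_neg_add_mul_ceil hΔ L (s ℓ i)) ε⟩
end

section
/- Let n be an even positive integer and let a, b : ZMod n → ℂ. Let F denote the discrete Fourier transform (F x)_k = Σ_{j ∈ ZMod n} x_j e^{−2πi·kj/n} and F^{−1} its inverse (F^{−1} w)_k = (1/n) Σ_{j ∈ ZMod n} w_j e^{2πi·kj/n}, and let D be the half-shift operator (D v)_i = v_{i + n/2}. Define c : ZMod n → ℂ by c_i = Σ_{j, m ∈ ZMod n with j + m = i + n/2} a_j · b_m. Then c = D(F^{−1}(F(D a) ⊙ F(D b))), where ⊙ denotes the pointwise (Hadamard) product. -/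
/-- The inverse discrete Fourier transform takes pointwise products to cyclic convolutions. -/
theorem ZMod.invDFT_dft_mul_dft {n : ℕ} [NeZero n] (x y : ZMod n → ℂ) :
    ZMod.dft.symm (fun t => ZMod.dft x t * ZMod.dft y t) = fun k => ∑ j, x j * y (k - j) := by
  rw [LinearEquiv.symm_apply_eq]
  funext t
  simp only [ZMod.dft_apply, smul_eq_mul]
  rw [Finset.sum_mul_sum]
  simp only [Finset.mul_sum]
  rw [Finset.sum_comm (s := Finset.univ) (t := Finset.univ)
    (f := fun k j => ZMod.stdAddChar (-(k * t)) * (x j * y (k - j)))]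
  refine Finset.sum_congr rfl fun j _ => Fintype.sum_equiv (Equiv.addRight j) _ _ fun m => ?_
  have h : -((m + j) * t) = -(j * t) + -(m * t) := by ring
  simp only [Equiv.coe_addRight, add_sub_cancel_right, h, AddChar.map_add_eq_mul]
  ring

theorem ZMod.stdAddChar_mul_eq_exp {n : ℕ} [NeZero n] (j k : ZMod n) :
    ZMod.stdAddChar (j * k) =
      Complex.exp (2 * (Real.pi : ℂ) * Complex.I * ((k.val : ℂ) * (j.val : ℂ)) / (n : ℂ)) := by
  have h := ZMod.stdAddChar_coe (N := n) ((k.val * j.val : ℕ) : ℤ)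
  push_cast [ZMod.natCast_zmod_val] at h
  rw [mul_comm j k, h]

theorem ZMod.stdAddChar_neg_mul_eq_exp {n : ℕ} [NeZero n] (j k : ZMod n) :
    ZMod.stdAddChar (-(j * k)) =
      Complex.exp (-2 * (Real.pi : ℂ) * Complex.I * ((k.val : ℂ) * (j.val : ℂ)) / (n : ℂ)) := by
  rw [AddChar.map_neg_eq_inv, ZMod.stdAddChar_mul_eq_exp, ← Complex.exp_neg]
  congr 1
  ring

open Finset

/-- Lemma 6: the coefficients of the 2L-periodised truncated convolution of two
discrete distributions on the grid are computed by `D F⁻¹(F(Da) ⊙ F(Db))`. -/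
theorem periodised_convolution_by_FFT
    (n : ℕ) [NeZero n] (hn : Even n) (a b : ZMod n → ℂ) :
    -- the discrete Fourier transform and its inverse
    let F : (ZMod n → ℂ) → (ZMod n → ℂ) := fun x k =>
      ∑ j : ZMod n, x j *
        Complex.exp (-2 * (Real.pi : ℂ) * Complex.I * ((k.val : ℂ) * (j.val : ℂ)) / (n : ℂ))
    let Finv : (ZMod n → ℂ) → (ZMod n → ℂ) := fun w k =>
      (n : ℂ)⁻¹ * ∑ j : ZMod n, w j *
        Complex.exp (2 * (Real.pi : ℂ) * Complex.I * ((k.val : ℂ) * (j.val : ℂ)) / (n : ℂ))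
    -- the half-shift operator D
    let D : (ZMod n → ℂ) → (ZMod n → ℂ) := fun v i => v (i + ((n / 2 : ℕ) : ZMod n))
    -- coefficients of the periodised truncated convolution
    let c : ZMod n → ℂ := fun i =>
      ∑ j : ZMod n, ∑ m : ZMod n,
        if j + m = i + ((n / 2 : ℕ) : ZMod n) then a j * b m else 0
    c = D (Finv fun t => F (D a) t * F (D b) t) := by
  intro F Finv D c
  have hF : ∀ x, F x = ZMod.dft x := fun x => by
    funext k
    simp only [F, ZMod.dft_apply, ZMod.stdAddChar_neg_mul_eq_exp, smul_eq_mul, mul_comm (x _)]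
  have hFinv : ∀ w, Finv w = ZMod.dft.symm w := fun w => by
    funext k
    simp only [Finv, ZMod.invDFT_apply, ZMod.stdAddChar_mul_eq_exp, smul_eq_mul, mul_comm (w _)]
  have hh : ((n / 2 : ℕ) : ZMod n) + ((n / 2 : ℕ) : ZMod n) = 0 := by
    rw [← Nat.cast_add, ← two_mul, Nat.two_mul_div_two_of_even hn, ZMod.natCast_self]
  rw [hFinv, hF, hF, ZMod.invDFT_dft_mul_dft]
  funext i
  simp only [c, D]
  generalize ((n / 2 : ℕ) : ZMod n) = h at hh
  symm
  refine Fintype.sum_equiv (Equiv.addRight h) _ _ fun j => ?_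
  have key : ∀ m, j + h + m = i + h ↔ m = i + h - j + h := fun m => by
    constructor <;> intro e
    · linear_combination e - hh
    · linear_combination e + hh
  simp [key]
end

section
/- Let L > 0, n an even positive integer, Δx = 2L/n, and grid points s_i = −L + i·Δx for 0 ≤ i ≤ n−1. For ℓ = 1,…,k let ω_ℓ be given by weights a_i^ℓ ≥ 0 at the grid points s_i with Σ_{i=0}^{n−1} a_i^ℓ ≤ 1. For ε > 0 define the exact value δ(ε) = Σ over index tuples (i_1,…,i_k) ∈ {0,…,n−1}^k of (∏_ℓ a_{i_ℓ}^ℓ) · max(1 − e^{ε − (s_{i_1} + ⋯ + s_{i_k})}, 0), and define the output of the Fourier accountant algorithm δ̃(ε) = Σ_{i : s_i > ε} (1 − e^{ε − s_i}) · c_i, where c_i = Σ over index tuples (i_1,…,i_k) with i_1 + ⋯ + i_k ≡ i + (k−1)·(n/2) (mod n) of ∏_ℓ a_{i_ℓ}^ℓ (these are the coefficients of the 2L-periodised truncated convolution of ω_1,…,ω_k). Define α^+(λ) = Σ_{ℓ=1}^k log(Σ_{i=0}^{n−1} a_i^ℓ e^{λ s_i}) and α^−(λ) = Σ_{ℓ=1}^k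 log(Σ_{i=0}^{n−1} a_i^ℓ e^{−λ s_i}). Then for every λ > 0, |δ(ε) − δ̃(ε)| ≤ (e^{α^+(λ)} + e^{α^−(λ)}) · e^{−Lλ}/(1 − e^{−2Lλ}). -/
open Finset

/-- The product of nonnegative moment generating functions is at most the exponential of the sum of
their logarithms, with no positivity needed. -/
theorem sum_prod_mul_exp_le_exp_sum_log {ι κ : Type*} [Fintype ι] [DecidableEq ι] [Fintype κ]
    (a : ι → κ → ℝ) (ha : ∀ ℓ i, 0 ≤ a ℓ i) (s : κ → ℝ) (x : ℝ) :
    ∑ t : ι → κ, (∏ ℓ, a ℓ (t ℓ)) * Real.exp (x * ∑ ℓ, s (t ℓ)) ≤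
      Real.exp (∑ ℓ, Real.log (∑ i, a ℓ i * Real.exp (x * s i))) := by
  calc ∑ t : ι → κ, (∏ ℓ, a ℓ (t ℓ)) * Real.exp (x * ∑ ℓ, s (t ℓ))
      = ∏ ℓ, ∑ i, a ℓ i * Real.exp (x * s i) := by
        rw [Finset.prod_univ_sum, Fintype.piFinset_univ]
        refine Finset.sum_congr rfl fun t _ => ?_
        rw [Finset.mul_sum, Real.exp_sum, Finset.prod_mul_distrib]
    _ ≤ Real.exp (∑ ℓ, Real.log (∑ i, a ℓ i * Real.exp (x * s i))) := by
        rw [Real.exp_sum]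
        exact Finset.prod_le_prod
          (fun ℓ _ => Finset.sum_nonneg fun i _ => mul_nonneg (ha ℓ i) (Real.exp_pos _).le)
          (fun ℓ _ => Real.le_exp_log _)

/-- Every residue class modulo `n`, shifted by `b`, has a unique representative in `Fin n`. -/
theorem exists_fin_natCast_eq_add_iff (n : ℕ) [NeZero n] (b N : ℕ) :
    ∃ j : Fin n, ∀ i : Fin n, ((N : ZMod n) = (((i : ℕ) + b : ℕ) : ZMod n)) ↔ j = i := by
  refine ⟨⟨((N : ZMod n) - b).val, ZMod.val_lt _⟩, fun i => ?_⟩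
  rw [Fin.ext_iff, Nat.cast_add, ← sub_eq_iff_eq_add]
  constructor
  · intro h
    simp only [h]
    exact ZMod.val_natCast_of_lt i.2
  · intro h
    simp only at h
    rw [← h, ZMod.natCast_zmod_val]

/-- A point congruent modulo `2 * L` to a point of `[-L, L)` either equals it or has modulus at
least `L`, so a function with values in `[0, 1]` changes by at most the exponential tail weight. -/
theorem abs_sub_le_exp_add_exp_mul_exp {L lam S r : ℝ} (hL : 0 < L) (hlam : 0 < lam) (m : ℤ)
    (hS : S = r + 2 * L * m) (hr0 : -L ≤ r) (hr1 : r < L)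
    (f : ℝ → ℝ) (hf0 : ∀ x, 0 ≤ f x) (hf1 : ∀ x, f x ≤ 1) :
    |f S - f r| ≤ (Real.exp (lam * S) + Real.exp (-lam * S)) * Real.exp (-L * lam) := by
  have hone : |f S - f r| ≤ 1 :=
    abs_le.2 ⟨by linarith [hf0 S, hf1 r], by linarith [hf1 S, hf0 r]⟩
  rw [add_mul, ← Real.exp_add, ← Real.exp_add]
  rcases lt_trichotomy m 0 with hm | rfl | hm
  · have hm' : (m : ℝ) ≤ -1 := by exact_mod_cast (by omega : m ≤ -1)
    have hSL : S ≤ -L := by nlinarith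
    have : 1 ≤ Real.exp (-lam * S + -L * lam) := Real.one_le_exp (by nlinarith)
    linarith [Real.exp_pos (lam * S + -L * lam)]
  · have : S = r := by simpa using hS
    rw [this, sub_self, abs_zero]
    positivity
  · have hm' : (1 : ℝ) ≤ m := by exact_mod_cast hm
    have hSL : L ≤ S := by nlinarith
    have : 1 ≤ Real.exp (lam * S + -L * lam) := Real.one_le_exp (by nlinarith)
    linarith [Real.exp_pos (-lam * S + -L * lam)]

/-- Theorem 7: the total periodisation and truncation error of the Fourier
accountant algorithm, for heterogeneous compositions of distributions supported
on the grid `s_i = -L + iΔx`, is bounded via the moment generating functions. -/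
theorem fourier_accountant_error_bound
    (L : ℝ) (hL : 0 < L) (n : ℕ) [NeZero n] (hn : Even n)
    (k : ℕ) (hk : 0 < k) (a : Fin k → Fin n → ℝ)
    (ha0 : ∀ ℓ i, 0 ≤ a ℓ i) (ha1 : ∀ ℓ, ∑ i, a ℓ i ≤ 1)
    (ε : ℝ) (hε : 0 < ε) :
    let Δx : ℝ := 2 * L / n
    let s : Fin n → ℝ := fun i => -L + ((i : ℕ) : ℝ) * Δx
    -- exact δ(ε) of the k-fold convolution
    let δ : ℝ := ∑ t : Fin k → Fin n,
      (∏ ℓ, a ℓ (t ℓ)) * max (1 - Real.exp (ε - ∑ ℓ, s (t ℓ))) 0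
    -- coefficients of the 2L-periodised truncated convolution
    let c : Fin n → ℝ := fun i => ∑ t : Fin k → Fin n,
      if ((∑ ℓ, ((t ℓ : ℕ)) : ℕ) : ZMod n) =
          ((((i : ℕ) + (k - 1) * (n / 2)) : ℕ) : ZMod n)
        then ∏ ℓ, a ℓ (t ℓ) else 0
    -- output of the Fourier accountant algorithm
    let δtilde : ℝ := ∑ i : Fin n,
      if ε < s i then (1 - Real.exp (ε - s i)) * c i else 0
    -- log moment generating functions
    let αp : ℝ → ℝ := fun lam => ∑ ℓ, Real.log (∑ i, a ℓ i * Real.exp (lam * s i))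
    let αm : ℝ → ℝ := fun lam => ∑ ℓ, Real.log (∑ i, a ℓ i * Real.exp (-lam * s i))
    ∀ lam : ℝ, 0 < lam →
      |δ - δtilde| ≤ (Real.exp (αp lam) + Real.exp (αm lam)) *
        (Real.exp (-L * lam) / (1 - Real.exp (-2 * L * lam))) := by
  intro Δx s δ c δtilde αp αm lam hlam
  have hn0 : (0 : ℝ) < n := by exact_mod_cast Nat.pos_of_ne_zero (NeZero.ne n)
  have hnΔ : (n : ℝ) * Δx = 2 * L := mul_div_cancel₀ _ hn0.ne'
  have hΔ : 0 < Δx := div_pos (by linarith) hn0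
  let f : ℝ → ℝ := fun x => max (1 - Real.exp (ε - x)) 0
  have hf0 : ∀ x, 0 ≤ f x := fun x => le_max_right _ _
  have hf1 : ∀ x, f x ≤ 1 := fun x =>
    max_le (by linarith [Real.exp_pos (ε - x)]) zero_le_one
  choose j hj using fun t : Fin k → Fin n =>
    exists_fin_natCast_eq_add_iff n ((k - 1) * (n / 2)) (∑ ℓ, ((t ℓ : ℕ)))
  have hδt : δtilde = ∑ t : Fin k → Fin n, (∏ ℓ, a ℓ (t ℓ)) * f (s (j t)) := by
    have hterm : ∀ i : Fin n, (if ε < s i then (1 - Real.exp (ε - s i)) * c i else 0) =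
        ∑ t : Fin k → Fin n, if j t = i then (∏ ℓ, a ℓ (t ℓ)) * f (s i) else 0 := by
      intro i
      have hc : c i = ∑ t : Fin k → Fin n, if j t = i then ∏ ℓ, a ℓ (t ℓ) else 0 :=
        Finset.sum_congr rfl fun t _ => if_congr (hj t i) rfl rfl
      have hf : (if ε < s i then (1 - Real.exp (ε - s i)) * c i else 0) = c i * f (s i) := by
        split_ifs with h
        · have : Real.exp (ε - s i) ≤ 1 := Real.exp_le_one_iff.2 (by linarith)
          rw [show f (s i) = 1 - Real.exp (ε - s i) from max_eq_left (by linarith), mul_comm]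
        · have : 1 ≤ Real.exp (ε - s i) := Real.one_le_exp (by linarith)
          rw [show f (s i) = 0 from max_eq_right (by linarith), mul_zero]
      rw [hf, hc, Finset.sum_mul]
      simp only [ite_mul, zero_mul]
    calc δtilde = ∑ i : Fin n, ∑ t : Fin k → Fin n,
          if j t = i then (∏ ℓ, a ℓ (t ℓ)) * f (s i) else 0 :=
          Finset.sum_congr rfl fun i _ => hterm i
      _ = _ := by
          rw [Finset.sum_comm]
          simp
  have hshift : ∀ t : Fin k → Fin n, ∃ m : ℤ, ∑ ℓ, s (t ℓ) = s (j t) + 2 * L * m := by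
    intro t
    have hmod := (hj t (j t)).2 rfl
    rw [ZMod.natCast_eq_natCast_iff] at hmod
    obtain ⟨m, hm⟩ := hmod.symm.dvd
    refine ⟨m, ?_⟩
    obtain ⟨h, rfl⟩ := hn
    obtain ⟨k, rfl⟩ := Nat.exists_eq_add_of_lt hk
    rw [show (h + h) / 2 = h by omega, show 0 + k + 1 - 1 = k by omega] at hm
    have hm' : (∑ ℓ, ((t ℓ : ℕ) : ℝ)) - (((j t : ℕ) : ℝ) + k * h) = (h + h) * m := by
      exact_mod_cast hm
    simp only [s, Finset.sum_add_distrib, ← Finset.sum_mul, Finset.sum_const, Finset.card_univ,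
      Fintype.card_fin, nsmul_eq_mul]
    push_cast at hnΔ ⊢
    linear_combination Δx * hm' + (m + k / 2 : ℝ) * hnΔ
  have hs0 : ∀ i, -L ≤ s i := fun i => le_add_of_nonneg_right (by positivity)
  have hs1 : ∀ i, s i < L := by
    intro i
    have : ((i : ℕ) : ℝ) < n := by exact_mod_cast i.2
    have : ((i : ℕ) : ℝ) * Δx < n * Δx := mul_lt_mul_of_pos_right this hΔ
    change -L + ((i : ℕ) : ℝ) * Δx < L
    linarith
  have hden : 0 < 1 - Real.exp (-2 * L * lam) :=
    sub_pos.2 (Real.exp_lt_one_iff.2 (by nlinarith [mul_pos hL hlam]))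
  have hP : ∀ t : Fin k → Fin n, 0 ≤ ∏ ℓ, a ℓ (t ℓ) := fun t =>
    Finset.prod_nonneg fun ℓ _ => ha0 ℓ _
  calc |δ - δtilde|
      = |∑ t : Fin k → Fin n, (∏ ℓ, a ℓ (t ℓ)) * (f (∑ ℓ, s (t ℓ)) - f (s (j t)))| := by
        simp only [hδt, mul_sub, Finset.sum_sub_distrib, δ, f]
    _ ≤ ∑ t : Fin k → Fin n, (∏ ℓ, a ℓ (t ℓ)) * |f (∑ ℓ, s (t ℓ)) - f (s (j t))| := by
        refine (Finset.abs_sum_le_sum_abs _ _).trans_eq (Finset.sum_congr rfl fun t _ => ?_)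
        rw [abs_mul, abs_of_nonneg (hP t)]
    _ ≤ ∑ t : Fin k → Fin n, (∏ ℓ, a ℓ (t ℓ)) * ((Real.exp (lam * ∑ ℓ, s (t ℓ)) +
          Real.exp (-lam * ∑ ℓ, s (t ℓ))) * Real.exp (-L * lam)) := by
        refine Finset.sum_le_sum fun t _ => mul_le_mul_of_nonneg_left ?_ (hP t)
        obtain ⟨m, hm⟩ := hshift t
        exact abs_sub_le_exp_add_exp_mul_exp hL hlam m hm (hs0 _) (hs1 _) f hf0 hf1
    _ = (∑ t : Fin k → Fin n, (∏ ℓ, a ℓ (t ℓ)) * Real.exp (lam * ∑ ℓ, s (t ℓ)) +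
          ∑ t : Fin k → Fin n, (∏ ℓ, a ℓ (t ℓ)) * Real.exp (-lam * ∑ ℓ, s (t ℓ))) *
            Real.exp (-L * lam) := by
        rw [← Finset.sum_add_distrib, Finset.sum_mul]
        exact Finset.sum_congr rfl fun t _ => by ring
    _ ≤ (Real.exp (αp lam) + Real.exp (αm lam)) * Real.exp (-L * lam) := by
        gcongr
        · exact sum_prod_mul_exp_le_exp_sum_log a ha0 s lam
        · exact sum_prod_mul_exp_le_exp_sum_log a ha0 s (-lam)
    _ ≤ (Real.exp (αp lam) + Real.exp (αm lam)) *
          (Real.exp (-L * lam) / (1 - Real.exp (-2 * L * lam))) := by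
        gcongr
        exact le_div_self (Real.exp_pos _).le hden (by linarith [Real.exp_pos (-2 * L * lam)])
end

section
/- Let n be an even positive integer, let F and F^{−1} denote the discrete Fourier transform and its inverse on ℂ^{ZMod n} ((F x)_k = Σ_j x_j e^{−2πi·kj/n}, (F^{−1} w)_k = (1/n) Σ_j w_j e^{2πi·kj/n}), and let D be the half-shift operator (D v)_i = v_{i + n/2}. Let a, w : ZMod n → ℝ (viewed as complex vectors), let k be a positive integer, and define b = D · F^{−1}( (F(D a))^{⊙k} ), where (·)^{⊙k} is the k-fold pointwise power. Then Σ_{ℓ ∈ ZMod n} w_ℓ · b_ℓ = (1/n) · Σ_{j ∈ ZMod n} conj( (F(D w))_j ) · ( (F(D a))_j )^k, i.e. ⟨w, b⟩ = (1/n)·⟨F(D w), (F(D a))^{⊙k}⟩ for the standard Hermitian inner product ⟨u,v⟩ = Σ_j conj(u_j) v_j. -/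
open Finset

/-- Lemma 11 (Plancherel speed-up): the inner product `⟨w, bᵏ⟩` with
`bᵏ = D F⁻¹((F(Da))^{⊙k})` can be computed in Fourier space as
`(1/n)·⟨F(Dw), (F(Da))^{⊙k}⟩`. -/
theorem plancherel_fast_evaluation
    (n : ℕ) [NeZero n] (hn : Even n) (a w : ZMod n → ℝ)
    (k : ℕ) (hk : 0 < k) :
    let F : (ZMod n → ℂ) → (ZMod n → ℂ) := fun x j =>
      ∑ m : ZMod n, x m *
        Complex.exp (-2 * (Real.pi : ℂ) * Complex.I * ((j.val : ℂ) * (m.val : ℂ)) / (n : ℂ))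
    let Finv : (ZMod n → ℂ) → (ZMod n → ℂ) := fun x j =>
      (n : ℂ)⁻¹ * ∑ m : ZMod n, x m *
        Complex.exp (2 * (Real.pi : ℂ) * Complex.I * ((j.val : ℂ) * (m.val : ℂ)) / (n : ℂ))
    let D : (ZMod n → ℂ) → (ZMod n → ℂ) := fun v i => v (i + ((n / 2 : ℕ) : ZMod n))
    let aC : ZMod n → ℂ := fun j => (a j : ℂ)
    let wC : ZMod n → ℂ := fun j => (w j : ℂ)
    let b : ZMod n → ℂ := D (Finv fun t => (F (D aC) t) ^ k)
    ∑ ℓ : ZMod n, wC ℓ * b ℓ =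
      (n : ℂ)⁻¹ * ∑ j : ZMod n, (starRingEnd ℂ) (F (D wC) j) * (F (D aC) j) ^ k := by
  intro F Finv D aC wC b
  have two_half : ((n / 2 : ℕ) : ZMod n) + ((n / 2 : ℕ) : ZMod n) = 0 := by
    rw [← Nat.cast_add, ← two_mul, Nat.two_mul_div_two_of_even hn, ZMod.natCast_self]
  have conj_exp (x y : ℕ) :
      (starRingEnd ℂ) (Complex.exp
        (-2 * (Real.pi : ℂ) * Complex.I * ((x : ℂ) * (y : ℂ)) / (n : ℂ))) =
      Complex.exp (2 * (Real.pi : ℂ) * Complex.I * ((y : ℂ) * (x : ℂ)) / (n : ℂ)) := by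
    rw [← Complex.exp_conj]
    simp only [map_div₀, map_mul, map_neg, map_ofNat, map_natCast, Complex.conj_ofReal,
      Complex.conj_I]
    ring_nf
  have conj_dft (j : ZMod n) : (starRingEnd ℂ) (F (D wC) j) = ∑ m : ZMod n,
      D wC m * Complex.exp
        (2 * (Real.pi : ℂ) * Complex.I * ((m.val : ℂ) * (j.val : ℂ)) / (n : ℂ)) := by
    simp only [F, D, wC, map_sum, map_mul, Complex.conj_ofReal, conj_exp]
  have b_shift (m : ZMod n) :
      b (m + ((n / 2 : ℕ) : ZMod n)) = Finv (fun t => (F (D aC) t) ^ k) m := by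
    change Finv _ (m + _ + _) = _
    rw [add_assoc, two_half, add_zero]
  rw [← Equiv.sum_comp (Equiv.addRight ((n / 2 : ℕ) : ZMod n))]
  simp only [Equiv.coe_addRight, b_shift, conj_dft]
  change ∑ m : ZMod n, D wC m * ((n : ℂ)⁻¹ * ∑ j : ZMod n, (F (D aC) j) ^ k * Complex.exp
    (2 * (Real.pi : ℂ) * Complex.I * ((m.val : ℂ) * (j.val : ℂ)) / (n : ℂ))) = _
  simp only [Finset.mul_sum, Finset.sum_mul]
  rw [Finset.sum_comm]
  exact Finset.sum_congr rfl fun j _ => Finset.sum_congr rfl fun m _ => by ring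
end

section
/- Let Δx > 0 and L > 0. For ℓ = 1,…,k, let ω_ℓ be given by a finitely supported function a^ℓ : ℤ → [0,∞) (weight a_j^ℓ at the point s_j = j·Δx) with Σ_j a_j^ℓ ≤ 1. Define the full convolution of two such weight functions by (a ∗ b)_i = Σ_{j ∈ ℤ} a_j b_{i−j} and the truncated convolution by (a ⊛ b)_i = Σ_{j : −L ≤ jΔx < L} a_j b_{i−j}, and form ω_1 ∗ ⋯ ∗ ω_k and the left-associated ω_1 ⊛ ⋯ ⊛ ω_k accordingly. Let α_ℓ^+(λ) = log(Σ_j a_j^ℓ e^{λ jΔx}) and α_ℓ^−(λ) = log(Σ_j a_j^ℓ e^{−λ jΔx}), and set A^+ = max_ℓ α_ℓ^+(λ), A^− = max_ℓ α_ℓ^−(λ). Then the coefficients of ω_1 ∗ ⋯ ∗ ω_k dominate those of ω_1 ⊛ ⋯ ⊛ ω_k pointwise, and for every λ > 0 the total deficiency satisfies Σ_{i ∈ ℤ} [ (ω_1 ∗ ⋯ ∗ ω_k)_i − (ω_1 ⊛ ⋯ ⊛ ω_k)_i ] ≤ ( Σ_{ℓ=1}^{k−1} e^{ℓ·A^+}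 + Σ_{ℓ=1}^{k−1} e^{ℓ·A^−} ) · e^{−Lλ}. -/
open Finset

/-- Full discrete convolution of weight functions on the grid `ℤ·Δx`. -/
noncomputable def convZ (a b : ℤ → ℝ) : ℤ → ℝ := fun i => ∑ᶠ j : ℤ, a j * b (i - j)

/-- Truncated discrete convolution: the inner sum is restricted to the grid
points `jΔx ∈ [-L, L)`. -/
noncomputable def tconvZ (L Δx : ℝ) (a b : ℤ → ℝ) : ℤ → ℝ := fun i =>
  ∑ᶠ j : ℤ, if -L ≤ (j : ℝ) * Δx ∧ (j : ℝ) * Δx < L then a j * b (i - j) else 0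

/-- Left-associated iteration `((a₀ ⋄ a₁) ⋄ a₂) ⋄ ⋯ ⋄ a_m` of a binary
operation on weight functions. -/
noncomputable def iterOp (op : (ℤ → ℝ) → (ℤ → ℝ) → (ℤ → ℝ))
    (a : ℕ → ℤ → ℝ) : ℕ → (ℤ → ℝ)
  | 0 => a 0
  | m + 1 => op (iterOp op a m) (a (m + 1))

/-- The grid indices retained by the truncated convolution. -/
def truncWindow (L Δx : ℝ) : Set ℤ := {j | -L ≤ (j : ℝ) * Δx ∧ (j : ℝ) * Δx < L}

lemma tconvZ_eq_convZ_indicator (L Δx : ℝ) (f g : ℤ → ℝ) :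
    tconvZ L Δx f g = convZ ((truncWindow L Δx).indicator f) g := by
  classical
  funext i
  simp only [tconvZ, convZ]
  refine finsum_congr fun j => ?_
  simp [Set.indicator_apply, truncWindow, ite_mul]

lemma convZ_nonneg {f g : ℤ → ℝ} (hf : ∀ j, 0 ≤ f j) (hg : ∀ j, 0 ≤ g j) (i : ℤ) :
    0 ≤ convZ f g i :=
  finsum_nonneg fun j => mul_nonneg (hf j) (hg _)

lemma convZ_apply_eq_sum {f : ℤ → ℝ} (hf : f.support.Finite) (g : ℤ → ℝ) (i : ℤ) :
    convZ f g i = ∑ j ∈ hf.toFinset, f j * g (i - j) := by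
  refine finsum_eq_sum_of_support_subset _ fun j hj => ?_
  simp only [Set.Finite.coe_toFinset]
  exact left_ne_zero_of_mul hj

lemma finite_support_convZ {f g : ℤ → ℝ} (hf : f.support.Finite) (hg : g.support.Finite) :
    (convZ f g).support.Finite := by
  refine (Set.Finite.image2 (fun x y : ℤ => x + y) hf hg).subset fun i hi => ?_
  rw [Function.mem_support, convZ_apply_eq_sum hf] at hi
  obtain ⟨j, -, hj⟩ := Finset.exists_ne_zero_of_sum_ne_zero hi
  exact ⟨j, left_ne_zero_of_mul hj, i - j, right_ne_zero_of_mul hj, by simp⟩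

lemma convZ_le_convZ_left {f f' g : ℤ → ℝ} (hf : f.support.Finite) (hf' : f'.support.Finite)
    (hff' : ∀ j, f j ≤ f' j) (hg : ∀ j, 0 ≤ g j) (i : ℤ) : convZ f g i ≤ convZ f' g i :=
  finsum_le_finsum' (hf.subset fun _ hj => left_ne_zero_of_mul hj)
    (hf'.subset fun _ hj => left_ne_zero_of_mul hj)
    fun j => mul_le_mul_of_nonneg_right (hff' j) (hg _)

/-- Summing a convolution against a multiplicative weight factors as a product. -/
lemma finsum_convZ_mul {f g w : ℤ → ℝ} (hf : f.support.Finite) (hg : g.support.Finite)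
    (hw : ∀ i j, w (i + j) = w i * w j) :
    ∑ᶠ i, convZ f g i * w i = (∑ᶠ j, f j * w j) * ∑ᶠ j, g j * w j := by
  simp_rw [convZ_apply_eq_sum hf, Finset.sum_mul]
  rw [finsum_sum_comm]
  · rw [finsum_eq_sum_of_support_subset (s := hf.toFinset) (fun j => f j * w j)
      fun j hj => by simpa using left_ne_zero_of_mul hj, Finset.sum_mul]
    refine Finset.sum_congr rfl fun j _ => ?_
    rw [mul_finsum, ← finsum_comp_equiv (Equiv.addLeft j)]
    refine finsum_congr fun i => ?_
    simp only [Equiv.coe_addLeft, add_sub_cancel_left, hw]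
    ring
  · intro j _
    refine (hg.image fun x => j + x).subset fun i hi => ?_
    exact ⟨i - j, right_ne_zero_of_mul (left_ne_zero_of_mul hi), by simp⟩

lemma finsum_convZ {f g : ℤ → ℝ} (hf : f.support.Finite) (hg : g.support.Finite) :
    ∑ᶠ i, convZ f g i = (∑ᶠ j, f j) * ∑ᶠ j, g j := by
  simpa using finsum_convZ_mul (w := fun _ => 1) hf hg (by simp)

lemma finite_support_indicator {f : ℤ → ℝ} (hf : f.support.Finite) (s : Set ℤ) :
    (s.indicator f).support.Finite :=
  hf.subset (Set.support_indicator.subset.trans Set.inter_subset_right)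

/-- Chernoff bound for the mass outside the truncation window. -/
lemma finsum_indicator_compl_truncWindow_le {f : ℤ → ℝ} (hf : f.support.Finite)
    (hf0 : ∀ j, 0 ≤ f j) (L Δx : ℝ) {lam : ℝ} (hlam : 0 < lam) :
    ∑ᶠ j, (truncWindow L Δx)ᶜ.indicator f j ≤
      ((∑ᶠ j : ℤ, f j * Real.exp (lam * ((j : ℝ) * Δx))) +
        ∑ᶠ j : ℤ, f j * Real.exp (-lam * ((j : ℝ) * Δx))) * Real.exp (-L * lam) := by
  have hfw (w : ℤ → ℝ) : (fun j => f j * w j).support.Finite :=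
    hf.subset fun _ hj => left_ne_zero_of_mul hj
  rw [← finsum_add_distrib (hfw _) (hfw _), finsum_mul]
  refine finsum_le_finsum' (finite_support_indicator hf _) (hf.subset fun j hj => ?_) fun j => ?_
  · contrapose! hj
    simp [Function.notMem_support.mp hj]
  refine Set.indicator_apply_le' (fun hj => ?_) fun _ => ?_
  · have key : 1 ≤ Real.exp (lam * ((j : ℝ) * Δx)) * Real.exp (-L * lam) +
        Real.exp (-lam * ((j : ℝ) * Δx)) * Real.exp (-L * lam) := by
      rw [← Real.exp_add, ← Real.exp_add]
      by_cases h : -L ≤ (j : ℝ) * Δx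
      · have h' : L ≤ (j : ℝ) * Δx := not_lt.mp fun h' => hj ⟨h, h'⟩
        have : 1 ≤ Real.exp (lam * ((j : ℝ) * Δx) + -L * lam) :=
          Real.one_le_exp (by nlinarith)
        linarith [Real.exp_pos (-lam * ((j : ℝ) * Δx) + -L * lam)]
      · have : 1 ≤ Real.exp (-lam * ((j : ℝ) * Δx) + -L * lam) :=
          Real.one_le_exp (by nlinarith)
        linarith [Real.exp_pos (lam * ((j : ℝ) * Δx) + -L * lam)]
    have := mul_le_mul_of_nonneg_left key (hf0 j)
    linarith
  · have := hf0 j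
    positivity

lemma finite_support_iterOp_convZ {a : ℕ → ℤ → ℝ} {m : ℕ}
    (hfin : ∀ ℓ ≤ m, (a ℓ).support.Finite) : (iterOp convZ a m).support.Finite := by
  induction m with
  | zero => exact hfin 0 le_rfl
  | succ m ih =>
    exact finite_support_convZ (ih fun ℓ hℓ => hfin ℓ (by omega)) (hfin _ le_rfl)

lemma finite_support_iterOp_tconvZ (L Δx : ℝ) {a : ℕ → ℤ → ℝ} {m : ℕ}
    (hfin : ∀ ℓ ≤ m, (a ℓ).support.Finite) : (iterOp (tconvZ L Δx) a m).support.Finite := by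
  induction m with
  | zero => exact hfin 0 le_rfl
  | succ m ih =>
    rw [iterOp, tconvZ_eq_convZ_indicator]
    exact finite_support_convZ
      (finite_support_indicator (ih fun ℓ hℓ => hfin ℓ (by omega)) _) (hfin _ le_rfl)

lemma iterOp_convZ_nonneg {a : ℕ → ℤ → ℝ} {m : ℕ} (ha0 : ∀ ℓ ≤ m, ∀ j, 0 ≤ a ℓ j) (i : ℤ) :
    0 ≤ iterOp convZ a m i := by
  induction m generalizing i with
  | zero => exact ha0 0 le_rfl i
  | succ m ih => exact convZ_nonneg (ih fun ℓ hℓ => ha0 ℓ (by omega)) (ha0 _ le_rfl) i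

lemma iterOp_tconvZ_nonneg (L Δx : ℝ) {a : ℕ → ℤ → ℝ} {m : ℕ}
    (ha0 : ∀ ℓ ≤ m, ∀ j, 0 ≤ a ℓ j) (i : ℤ) : 0 ≤ iterOp (tconvZ L Δx) a m i := by
  induction m generalizing i with
  | zero => exact ha0 0 le_rfl i
  | succ m ih =>
    rw [iterOp, tconvZ_eq_convZ_indicator]
    exact convZ_nonneg
      (fun _ => Set.indicator_nonneg (fun j _ => ih (fun ℓ hℓ => ha0 ℓ (by omega)) j) _)
      (ha0 _ le_rfl) i

lemma iterOp_tconvZ_le_iterOp_convZ (L Δx : ℝ) {a : ℕ → ℤ → ℝ} {m : ℕ}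
    (ha0 : ∀ ℓ ≤ m, ∀ j, 0 ≤ a ℓ j) (hfin : ∀ ℓ ≤ m, (a ℓ).support.Finite) (i : ℤ) :
    iterOp (tconvZ L Δx) a m i ≤ iterOp convZ a m i := by
  induction m generalizing i with
  | zero => exact le_rfl
  | succ m ih =>
    have ha0' : ∀ ℓ ≤ m, ∀ j, 0 ≤ a ℓ j := fun ℓ hℓ => ha0 ℓ (by omega)
    have hfin' : ∀ ℓ ≤ m, (a ℓ).support.Finite := fun ℓ hℓ => hfin ℓ (by omega)
    rw [iterOp, iterOp, tconvZ_eq_convZ_indicator]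
    refine convZ_le_convZ_left
      (finite_support_indicator (finite_support_iterOp_tconvZ L Δx hfin') _)
      (finite_support_iterOp_convZ hfin') (fun j => ?_) (ha0 _ le_rfl) i
    exact (Set.indicator_le_self' (fun _ _ => iterOp_tconvZ_nonneg L Δx ha0' _) j).trans
      (ih ha0' hfin' j)

/-- An exponential moment of an iterated convolution is controlled by those of the factors. -/
lemma finsum_iterOp_convZ_mul_exp_le {a : ℕ → ℤ → ℝ} {m : ℕ} (c Δx A : ℝ)
    (ha0 : ∀ ℓ ≤ m, ∀ j, 0 ≤ a ℓ j) (hfin : ∀ ℓ ≤ m, (a ℓ).support.Finite)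
    (hA : ∀ ℓ ≤ m, ∑ᶠ j : ℤ, a ℓ j * Real.exp (c * ((j : ℝ) * Δx)) ≤ Real.exp A) :
    ∑ᶠ j : ℤ, iterOp convZ a m j * Real.exp (c * ((j : ℝ) * Δx)) ≤
      Real.exp ((m + 1 : ℕ) * A) := by
  induction m with
  | zero => simpa [iterOp] using hA 0 le_rfl
  | succ m ih =>
    rw [iterOp, finsum_convZ_mul
      (finite_support_iterOp_convZ fun ℓ hℓ => hfin ℓ (by omega)) (hfin _ le_rfl)
      (fun i j => by rw [← Real.exp_add]; push_cast; ring_nf)]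
    refine (mul_le_mul (ih (fun ℓ hℓ => ha0 ℓ (by omega)) (fun ℓ hℓ => hfin ℓ (by omega))
      fun ℓ hℓ => hA ℓ (by omega)) (hA _ le_rfl)
      (finsum_nonneg fun j => mul_nonneg (ha0 _ le_rfl j) (Real.exp_pos _).le)
      (Real.exp_pos _).le).trans_eq ?_
    rw [← Real.exp_add]
    push_cast
    ring_nf

lemma finsum_iterOp_convZ_le_add {a : ℕ → ℤ → ℝ} {m : ℕ} (L Δx : ℝ) {lam : ℝ} (hlam : 0 < lam)
    (Ap Am : ℝ) (ha0 : ∀ ℓ ≤ m, ∀ j, 0 ≤ a ℓ j) (hfin : ∀ ℓ ≤ m, (a ℓ).support.Finite)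
    (ha1 : ∀ ℓ ≤ m, ∑ᶠ j, a ℓ j ≤ 1)
    (hAp : ∀ ℓ ≤ m, ∑ᶠ j : ℤ, a ℓ j * Real.exp (lam * ((j : ℝ) * Δx)) ≤ Real.exp Ap)
    (hAm : ∀ ℓ ≤ m, ∑ᶠ j : ℤ, a ℓ j * Real.exp (-lam * ((j : ℝ) * Δx)) ≤ Real.exp Am) :
    ∑ᶠ i, iterOp convZ a m i ≤ ∑ᶠ i, iterOp (tconvZ L Δx) a m i +
      ((∑ ℓ ∈ Finset.range m, Real.exp ((ℓ + 1 : ℕ) * Ap)) +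
        ∑ ℓ ∈ Finset.range m, Real.exp ((ℓ + 1 : ℕ) * Am)) * Real.exp (-L * lam) := by
  induction m with
  | zero => simp [iterOp]
  | succ m ih =>
    have ha0' : ∀ ℓ ≤ m, ∀ j, 0 ≤ a ℓ j := fun ℓ hℓ => ha0 ℓ (by omega)
    have hfin' : ∀ ℓ ≤ m, (a ℓ).support.Finite := fun ℓ hℓ => hfin ℓ (by omega)
    have hAp' := fun ℓ (hℓ : ℓ ≤ m) => hAp ℓ (by omega)
    have hAm' := fun ℓ (hℓ : ℓ ≤ m) => hAm ℓ (by omega)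
    specialize ih ha0' hfin' (fun ℓ hℓ => ha1 ℓ (by omega)) hAp' hAm'
    have hS := finite_support_iterOp_convZ hfin'
    have hT := finite_support_iterOp_tconvZ L Δx hfin'
    rw [iterOp, iterOp, tconvZ_eq_convZ_indicator, finsum_convZ hS (hfin _ le_rfl),
      finsum_convZ (finite_support_indicator hT _) (hfin _ le_rfl),
      Finset.sum_range_succ, Finset.sum_range_succ]
    set W := truncWindow L Δx
    set S := iterOp convZ a m
    set T := iterOp (tconvZ L Δx) a m
    have hsplit : ∑ᶠ i, T i = ∑ᶠ i, W.indicator T i + ∑ᶠ i, Wᶜ.indicator T i := by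
      rw [← finsum_add_distrib (finite_support_indicator hT _) (finite_support_indicator hT _)]
      exact finsum_congr fun i => (congrFun (Set.indicator_self_add_compl W T) i).symm
    have htail : ∑ᶠ i, Wᶜ.indicator T i ≤
        (Real.exp ((m + 1 : ℕ) * Ap) + Real.exp ((m + 1 : ℕ) * Am)) * Real.exp (-L * lam) :=
      calc ∑ᶠ i, Wᶜ.indicator T i
          ≤ ∑ᶠ i, Wᶜ.indicator S i :=
            finsum_le_finsum' (finite_support_indicator hT _) (finite_support_indicator hS _)
              fun i => Set.indicator_le_indicator
                (iterOp_tconvZ_le_iterOp_convZ L Δx ha0' hfin' i)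
        _ ≤ _ := finsum_indicator_compl_truncWindow_le hS (iterOp_convZ_nonneg ha0') L Δx hlam
        _ ≤ _ := mul_le_mul_of_nonneg_right
            (add_le_add (finsum_iterOp_convZ_mul_exp_le lam Δx Ap ha0' hfin' hAp')
              (finsum_iterOp_convZ_mul_exp_le (-lam) Δx Am ha0' hfin' hAm'))
            (Real.exp_pos _).le
    set B := ((∑ ℓ ∈ Finset.range m, Real.exp ((ℓ + 1 : ℕ) * Ap)) +
        ∑ ℓ ∈ Finset.range m, Real.exp ((ℓ + 1 : ℕ) * Am)) * Real.exp (-L * lam) with hB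
    set C := (Real.exp ((m + 1 : ℕ) * Ap) + Real.exp ((m + 1 : ℕ) * Am)) * Real.exp (-L * lam)
      with hC
    have hBC : 0 ≤ B + C := by positivity
    have hs0 : 0 ≤ ∑ᶠ j, a (m + 1) j := finsum_nonneg (ha0 _ le_rfl)
    calc (∑ᶠ i, S i) * ∑ᶠ j, a (m + 1) j
        ≤ (∑ᶠ i, W.indicator T i + (B + C)) * ∑ᶠ j, a (m + 1) j :=
          mul_le_mul_of_nonneg_right (by linarith) hs0
      _ ≤ (∑ᶠ i, W.indicator T i) * ∑ᶠ j, a (m + 1) j + (B + C) := by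
          rw [add_mul]
          gcongr
          exact mul_le_of_le_one_right hBC (ha1 _ le_rfl)
      _ = _ := by rw [hB, hC]; ring

/-- Appendix truncation-error theorem: the full convolution dominates the
truncated convolution pointwise, and the total deficiency is bounded by
`(Σ_{ℓ=1}^{k-1} e^{ℓA⁺} + Σ_{ℓ=1}^{k-1} e^{ℓA⁻}) e^{-Lλ}`. -/
theorem truncation_error_bound
    (k : ℕ) (hk : 1 ≤ k) (L Δx : ℝ) (hL : 0 < L) (hΔx : 0 < Δx)
    (a : ℕ → ℤ → ℝ)
    (ha0 : ∀ ℓ < k, ∀ j : ℤ, 0 ≤ a ℓ j)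
    (hfin : ∀ ℓ < k, (Function.support (a ℓ)).Finite)
    (ha1 : ∀ ℓ < k, ∑ᶠ j : ℤ, a ℓ j ≤ 1) :
    -- pointwise domination
    (∀ i : ℤ, iterOp (tconvZ L Δx) a (k - 1) i ≤ iterOp convZ a (k - 1) i) ∧
    -- total deficiency bound
    (∀ lam : ℝ, 0 < lam →
      let Ap : ℝ := (Finset.range k).sup'
        (Finset.nonempty_range_iff.mpr (Nat.one_le_iff_ne_zero.mp hk))
        fun ℓ => Real.log (∑ᶠ j : ℤ, a ℓ j * Real.exp (lam * ((j : ℝ) * Δx)))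
      let Am : ℝ := (Finset.range k).sup'
        (Finset.nonempty_range_iff.mpr (Nat.one_le_iff_ne_zero.mp hk))
        fun ℓ => Real.log (∑ᶠ j : ℤ, a ℓ j * Real.exp (-lam * ((j : ℝ) * Δx)))
      ∑ᶠ i : ℤ, (iterOp convZ a (k - 1) i - iterOp (tconvZ L Δx) a (k - 1) i) ≤
        ((∑ ℓ ∈ Finset.range (k - 1), Real.exp ((ℓ + 1 : ℕ) * Ap)) +
         (∑ ℓ ∈ Finset.range (k - 1), Real.exp ((ℓ + 1 : ℕ) * Am))) *
          Real.exp (-L * lam)) := by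
  have hlt {ℓ : ℕ} (hℓ : ℓ ≤ k - 1) : ℓ < k := by omega
  have ha0' : ∀ ℓ ≤ k - 1, ∀ j, 0 ≤ a ℓ j := fun ℓ hℓ => ha0 ℓ (hlt hℓ)
  have hfin' : ∀ ℓ ≤ k - 1, (a ℓ).support.Finite := fun ℓ hℓ => hfin ℓ (hlt hℓ)
  refine ⟨iterOp_tconvZ_le_iterOp_convZ L Δx ha0' hfin', ?_⟩
  intro lam hlam Ap Am
  rw [finsum_sub_distrib (finite_support_iterOp_convZ hfin')
    (finite_support_iterOp_tconvZ L Δx hfin'), sub_le_iff_le_add']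
  refine finsum_iterOp_convZ_le_add L Δx hlam Ap Am ha0' hfin' (fun ℓ hℓ => ha1 ℓ (hlt hℓ))
    (fun ℓ hℓ => ?_) fun ℓ hℓ => ?_
  all_goals
    refine (Real.le_exp_log _).trans (Real.exp_le_exp.mpr ?_)
  · exact Finset.le_sup'
      (fun ℓ => Real.log (∑ᶠ j : ℤ, a ℓ j * Real.exp (lam * ((j : ℝ) * Δx))))
      (Finset.mem_range.mpr (hlt hℓ))
  · exact Finset.le_sup'
      (fun ℓ => Real.log (∑ᶠ j : ℤ, a ℓ j * Real.exp (-lam * ((j : ℝ) * Δx))))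
      (Finset.mem_range.mpr (hlt hℓ))
end

section
/- Fix d ≥ 1, σ > 0, q ∈ [0,1], ε > 0 and δ ∈ [0,1]. Let 𝒳 be a type, X a finite set of elements of 𝒳, x' ∉ X, and X' = X ∪ {x'}. Let g : 𝒳 → ℝ^d satisfy ‖g(x)‖₂ = 1 for all x, and set f(T) = Σ_{x ∈ T} g(x) for T ⊆ X (respectively T ⊆ X'). Define the Poisson subsampled Gaussian mechanism on a dataset Z as the mixture measure M(Z) = Σ_{T ⊆ Z} q^{|T|}(1−q)^{|Z|−|T|} · N(f(T), σ²I_d), where N(μ, σ²I_d) denotes the Gaussian measure on ℝ^d with mean μ and covariance σ²I_d (the pushforward under translation by μ of the d-fold product of centered real Gaussians of variance σ²). If the one-dimensional measures gaussianReal 0 σ² and (1−q)·gaussianReal 0 σ² + q·gaussianReal 1 σ² are (ε,δ)-indistinguishable, then M(X) and M(X') are (ε,δ)-indistinguishable. -/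
open MeasureTheory ProbabilityTheory Finset

/-- The Gaussian measure `N(m, σ²I_d)` on `ℝ^d`: the pushforward under
translation by `m` of the `d`-fold product of centered real Gaussians. -/
noncomputable def gaussVec (d : ℕ) (v : NNReal) (m : Fin d → ℝ) :
    Measure (Fin d → ℝ) :=
  Measure.map (fun t => m + t) (Measure.pi fun _ : Fin d => gaussianReal 0 v)

/-- `(ε,δ)`-indistinguishability of two measures. -/
def Indist {Ω : Type*} [MeasurableSpace Ω] (P Q : Measure Ω) (ε δ : ℝ) : Prop :=
  ∀ E : Set Ω, MeasurableSet E →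
    P E ≤ ENNReal.ofReal (Real.exp ε) * Q E + ENNReal.ofReal δ ∧
    Q E ≤ ENNReal.ofReal (Real.exp ε) * P E + ENNReal.ofReal δ

namespace Indist

variable {Ω Ω' : Type*} [MeasurableSpace Ω] [MeasurableSpace Ω'] {P Q : Measure Ω} {ε δ : ℝ}

lemma map (h : Indist P Q ε δ) {f : Ω → Ω'} (hf : Measurable f) :
    Indist (P.map f) (Q.map f) ε δ := by
  intro E hE
  rw [Measure.map_apply hf hE, Measure.map_apply hf hE]
  exact h _ (hf hE)

lemma prod [SFinite P] [SFinite Q] (h : Indist P Q ε δ) (ρ : Measure Ω')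
    [IsProbabilityMeasure ρ] : Indist (P.prod ρ) (Q.prod ρ) ε δ := by
  have key : ∀ {μ ν : Measure Ω} [SFinite μ] [SFinite ν],
      (∀ E, MeasurableSet E →
        μ E ≤ ENNReal.ofReal (Real.exp ε) * ν E + ENNReal.ofReal δ) →
      ∀ E, MeasurableSet E →
        (μ.prod ρ) E ≤ ENNReal.ofReal (Real.exp ε) * (ν.prod ρ) E + ENNReal.ofReal δ := by
    intro μ ν _ _ hμν E hE
    rw [Measure.prod_apply_symm hE, Measure.prod_apply_symm hE,
      ← lintegral_const_mul _ (measurable_measure_prodMk_right hE)]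
    calc _ ≤ ∫⁻ y, (ENNReal.ofReal (Real.exp ε) * ν ((fun x => (x, y)) ⁻¹' E)
          + ENNReal.ofReal δ) ∂ρ :=
          lintegral_mono fun y => hμν _ (measurable_prodMk_right hE)
      _ = _ := by
          rw [lintegral_add_right _ measurable_const]
          simp
  exact fun E hE => ⟨key (fun E hE => (h E hE).1) E hE, key (fun E hE => (h E hE).2) E hE⟩

lemma sum_smul {ι : Type*} {s : Finset ι} {w : ι → ENNReal} (hw : ∑ i ∈ s, w i ≤ 1)
    {P Q : ι → Measure Ω} (h : ∀ i ∈ s, Indist (P i) (Q i) ε δ) :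
    Indist (∑ i ∈ s, w i • P i) (∑ i ∈ s, w i • Q i) ε δ := by
  have key : ∀ {a b : ι → ENNReal},
      (∀ i ∈ s, a i ≤ ENNReal.ofReal (Real.exp ε) * b i + ENNReal.ofReal δ) →
      ∑ i ∈ s, w i * a i ≤
        ENNReal.ofReal (Real.exp ε) * ∑ i ∈ s, w i * b i + ENNReal.ofReal δ := by
    intro a b hab
    calc ∑ i ∈ s, w i * a i
        ≤ ∑ i ∈ s, w i * (ENNReal.ofReal (Real.exp ε) * b i + ENNReal.ofReal δ) :=
          Finset.sum_le_sum fun i hi => mul_le_mul_right (hab i hi) _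
      _ = ENNReal.ofReal (Real.exp ε) * ∑ i ∈ s, w i * b i
          + (∑ i ∈ s, w i) * ENNReal.ofReal δ := by
          rw [Finset.mul_sum, Finset.sum_mul, ← Finset.sum_add_distrib]
          exact Finset.sum_congr rfl fun i _ => by ring
      _ ≤ ENNReal.ofReal (Real.exp ε) * ∑ i ∈ s, w i * b i + ENNReal.ofReal δ := by
          gcongr
          exact mul_le_of_le_one_left zero_le hw
  intro E hE
  simp only [Measure.coe_finsetSum, Finset.sum_apply, Measure.smul_apply, smul_eq_mul]
  exact ⟨key fun i hi => (h i hi E hE).1, key fun i hi => (h i hi E hE).2⟩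

end Indist

lemma charFunDual_gaussianReal (c : ℝ) (v : NNReal) (L : StrongDual ℝ ℝ) :
    charFunDual (gaussianReal c v) L =
      Complex.exp (L 1 * c * Complex.I - v * (L 1 : ℂ) ^ 2 / 2) := by
  rw [← charFun_gaussianReal, charFunDual_apply, charFun_apply_real]
  congr 1 with x
  have : L x = L 1 * x := by
    conv_lhs => rw [← mul_one x, ← smul_eq_mul, map_smul, smul_eq_mul, mul_comm]
  rw [this]
  push_cast
  rfl

lemma charFunDual_pi_gaussianReal (d : ℕ) (v : NNReal) (L : StrongDual ℝ (Fin d → ℝ)) :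
    charFunDual (Measure.pi fun _ : Fin d => gaussianReal 0 v) L =
      Complex.exp (-(v * ((∑ i, L (Pi.single i 1) ^ 2 : ℝ) : ℂ) / 2)) := by
  rw [charFunDual_pi]
  simp only [charFunDual_gaussianReal]
  rw [← Complex.exp_sum]
  congr 1
  simp [Finset.mul_sum, Finset.sum_div]

/-- Replaces the component of `p.2` in the direction `u` by `p.1`. -/
noncomputable def replaceComponent {d : ℕ} (u : Fin d → ℝ) :
    ℝ × (Fin d → ℝ) →L[ℝ] (Fin d → ℝ) :=
  LinearMap.toContinuousLinearMap
    { toFun := fun p => p.1 • u + (p.2 - (u ⬝ᵥ p.2) • u)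
      map_add' := fun a b => by
        simp only [Prod.fst_add, Prod.snd_add, dotProduct_add]
        module
      map_smul' := fun r a => by
        simp only [Prod.smul_fst, Prod.smul_snd, dotProduct_smul, smul_eq_mul, RingHom.id_apply]
        module }

lemma replaceComponent_apply {d : ℕ} (u : Fin d → ℝ) (p : ℝ × (Fin d → ℝ)) :
    replaceComponent u p = p.1 • u + (p.2 - (u ⬝ᵥ p.2) • u) := rfl

lemma gaussVec_smul_eq_map {d : ℕ} (v : NNReal) (c : ℝ) {u : Fin d → ℝ}
    (hu : ∑ i, u i ^ 2 = 1) :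
    gaussVec d v (c • u) = ((gaussianReal c v).prod
      (Measure.pi fun _ : Fin d => gaussianReal 0 v)).map (replaceComponent u) := by
  have : IsProbabilityMeasure (gaussVec d v (c • u)) :=
    Measure.isProbabilityMeasure_map (by fun_prop)
  have : IsProbabilityMeasure (((gaussianReal c v).prod
      (Measure.pi fun _ : Fin d => gaussianReal 0 v)).map (replaceComponent u)) :=
    Measure.isProbabilityMeasure_map (by fun_prop)
  refine Measure.ext_of_charFunDual (funext fun L => ?_)
  rw [gaussVec, charFunDual_map_const_add, charFunDual_map, charFunDual_prod,
    charFunDual_pi_gaussianReal, charFunDual_pi_gaussianReal, charFunDual_gaussianReal,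
    ← Complex.exp_add, ← Complex.exp_add]
  congr 1
  have hLu : ∑ i, u i * L (Pi.single i 1) = L u := by
    conv_rhs => rw [pi_eq_sum_univ' u]
    simp
  have hsq : ∑ i, (L (Pi.single i 1) - u i * L u) ^ 2
      = ∑ i, L (Pi.single i 1) ^ 2 - L u ^ 2 := by
    calc _ = ∑ i, L (Pi.single i 1) ^ 2 - 2 * L u * ∑ i, u i * L (Pi.single i 1)
          + L u ^ 2 * ∑ i, u i ^ 2 := by
          rw [Finset.mul_sum, Finset.mul_sum, ← Finset.sum_sub_distrib, ← Finset.sum_add_distrib]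
          exact Finset.sum_congr rfl fun i _ => by ring
      _ = _ := by rw [hLu, hu]; ring
  have hfst : (L.comp (replaceComponent u)).comp (.inl ℝ ℝ (Fin d → ℝ)) 1 = L u := by
    simp [replaceComponent_apply]
  have hsnd : ∀ i, (L.comp (replaceComponent u)).comp (.inr ℝ ℝ (Fin d → ℝ)) (Pi.single i 1)
      = L (Pi.single i 1) - u i * L u := by
    intro i
    simp [replaceComponent_apply]
  simp only [hfst, hsnd, hsq, map_smul, smul_eq_mul]
  push_cast
  ring

lemma gaussVec_add (d : ℕ) (v : NNReal) (m a : Fin d → ℝ) :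
    gaussVec d v (m + a) = (gaussVec d v a).map (m + ·) := by
  rw [gaussVec, gaussVec, Measure.map_map (by fun_prop) (by fun_prop)]
  congr 1 with t : 1
  simp [add_assoc]

lemma Indist.gaussVec_of_gaussianReal {d : ℕ} {v : NNReal} {a b : ENNReal} {ε δ : ℝ}
    (h : Indist (gaussianReal 0 v) (a • gaussianReal 0 v + b • gaussianReal 1 v) ε δ)
    (m : Fin d → ℝ) {u : Fin d → ℝ} (hu : ∑ i, u i ^ 2 = 1) :
    Indist (gaussVec d v m) (a • gaussVec d v m + b • gaussVec d v (m + u)) ε δ := by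
  have h0 := gaussVec_smul_eq_map v 0 hu
  have h1 := gaussVec_smul_eq_map v 1 hu
  have := ((h.prod (Measure.pi fun _ : Fin d => gaussianReal 0 v)).map
    (replaceComponent u).measurable).map (measurable_const_add m)
  rw [Measure.add_prod, Measure.prod_smul_left, Measure.prod_smul_left,
    Measure.map_add _ _ (replaceComponent u).measurable, Measure.map_smul, Measure.map_smul,
    ← h0, ← h1, Measure.map_add _ _ (measurable_const_add m), Measure.map_smul, Measure.map_smul,
    ← gaussVec_add, ← gaussVec_add] at this
  simpa using this

/-- Theorem (appendix): if the one-dimensional Gaussian/mixture pair is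
(ε,δ)-indistinguishable, then so is the multivariate Poisson subsampled
Gaussian mechanism with sensitivity 1 on neighbouring datasets `X ⊆ X' = X ∪ {x'}`. -/
theorem subsampled_gaussian_reduction_to_1d
    {𝒳 : Type*} [DecidableEq 𝒳] (d : ℕ) (hd : 1 ≤ d) (σ : ℝ) (hσ : 0 < σ)
    (q : ℝ) (hq : q ∈ Set.Icc (0 : ℝ) 1)
    (ε δ : ℝ) (hε : 0 < ε) (hδ : δ ∈ Set.Icc (0 : ℝ) 1)
    (X : Finset 𝒳) (x' : 𝒳) (hx' : x' ∉ X)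
    (g : 𝒳 → Fin d → ℝ) (hg : ∀ x, ∑ i, (g x i) ^ 2 = 1)
    (M : Finset 𝒳 → Measure (Fin d → ℝ))
    (hM : ∀ Z : Finset 𝒳, M Z = ∑ T ∈ Z.powerset,
        ENNReal.ofReal (q ^ T.card * (1 - q) ^ (Z.card - T.card)) •
          gaussVec d (Real.toNNReal (σ ^ 2)) (∑ x ∈ T, g x))
    (h1d : Indist (gaussianReal 0 (Real.toNNReal (σ ^ 2)))
        (ENNReal.ofReal (1 - q) • gaussianReal 0 (Real.toNNReal (σ ^ 2)) +
         ENNReal.ofReal q • gaussianReal 1 (Real.toNNReal (σ ^ 2))) ε δ) :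
    Indist (M X) (M (insert x' X)) ε δ := by
  obtain ⟨hq0, hq1⟩ := hq
  have hq1' : 0 ≤ 1 - q := sub_nonneg.2 hq1
  set v := Real.toNNReal (σ ^ 2)
  have hM' : M (insert x' X) = ∑ T ∈ X.powerset,
      ENNReal.ofReal (q ^ T.card * (1 - q) ^ (X.card - T.card)) •
        (ENNReal.ofReal (1 - q) • gaussVec d v (∑ x ∈ T, g x) +
          ENNReal.ofReal q • gaussVec d v (∑ x ∈ T, g x + g x')) := by
    rw [hM, Finset.sum_powerset_insert hx', ← Finset.sum_add_distrib]
    refine Finset.sum_congr rfl fun T hT => ?_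
    have hTX := Finset.mem_powerset.1 hT
    have hxT : x' ∉ T := fun h => hx' (hTX h)
    have hcard := Finset.card_le_card hTX
    rw [Finset.card_insert_of_notMem hx', Finset.card_insert_of_notMem hxT,
      Finset.sum_insert hxT, Nat.add_sub_add_right, Nat.sub_add_comm hcard, smul_add, smul_smul,
      smul_smul, ← ENNReal.ofReal_mul (by positivity), ← ENNReal.ofReal_mul (by positivity),
      add_comm (g x')]
    congr 3 <;> ring
  rw [hM', hM]
  refine Indist.sum_smul ?_ fun T _ => h1d.gaussVec_of_gaussianReal _ (hg x')
  rw [← ENNReal.ofReal_sum_of_nonneg fun T _ => by positivity,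
    Finset.sum_pow_mul_eq_add_pow]
  simp
end

section
/- Fix d ≥ 1 and σ > 0, and for μ ∈ ℝ^d let φ_μ(t) = (2πσ²)^{−d/2} exp(−‖t−μ‖₂²/(2σ²)) be the density of the Gaussian N(μ, σ²I_d). Let v ∈ ℝ^d, let g₁ ∈ ℝ^d with ‖g₁‖₂ = 1, and let m, g₂ : ℝ^d → ℝ^d be measurable with ‖g₂(t)‖₂ = 1 for all t. Define probability densities on ℝ^d × ℝ^d (with respect to Lebesgue measure) by f_X(t₁, t₂) = φ_v(t₁)·φ_{m(t₁)}(t₂) (the two-step adaptive Gaussian mechanism on dataset X) and f_{X'}(t₁, t₂) = φ_{v + g₁}(t₁)·φ_{m(t₁) + g₂(t₁)}(t₂) (the mechanism on the neighbouring dataset X'). Then the pushforward of the probability measure with density f_{X'} under the privacy loss function L(t₁, t₂) = log( f_{X'}(t₁,t₂) / f_X(t₁,t₂) ) is the one-dimensional Gaussian measure gaussianReal (1/σ²) (2/σ²), i.e. the privacy loss distribution of the two-fold adaptive d-dimensional composition equals that of the two-fold non-adaptive composition of one-dimensional Gaussian mechanisms with sensitivity 1. -/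
open MeasureTheory ProbabilityTheory Finset

open scoped NNReal ENNReal

lemma pi_gaussianReal_eq_withDensity {ι : Type*} [Fintype ι] (μ : ι → ℝ) {v : ℝ≥0} (hv : v ≠ 0) :
    Measure.pi (fun i => gaussianReal (μ i) v) =
      (volume : Measure (ι → ℝ)).withDensity
        fun t => ENNReal.ofReal (∏ i, gaussianPDFReal (μ i) v (t i)) := by
  refine Measure.pi_eq fun s hs => ?_
  rw [withDensity_apply _ (MeasurableSet.univ_pi hs), volume_pi, Measure.restrict_pi_pi,
    ← ofReal_integral_eq_lintegral_ofReal, integral_fintype_prod_eq_prod,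
    ENNReal.ofReal_prod_of_nonneg]
  · exact Finset.prod_congr rfl fun i _ => (gaussianReal_apply_eq_integral _ hv _).symm
  · exact fun i _ => integral_nonneg fun _ => gaussianPDFReal_nonneg _ _ _
  · exact Integrable.fintype_prod fun i => (integrable_gaussianPDFReal _ _).restrict
  · exact ae_of_all _ fun t => Finset.prod_nonneg fun i _ => gaussianPDFReal_nonneg _ _ _

lemma map_sum_mul_pi_gaussianReal {ι : Type*} [Fintype ι] (μ a : ι → ℝ) (v : ℝ≥0) :
    (Measure.pi fun i => gaussianReal (μ i) v).map (fun t => ∑ i, a i * t i) =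
      gaussianReal (∑ i, a i * μ i) (Real.toNNReal (∑ i, a i ^ 2) * v) := by
  have hmeas : Measurable fun t : ι → ℝ => ∑ i, a i * t i := by fun_prop
  refine Measure.ext_of_charFun (funext fun s => ?_)
  rw [charFun_apply_real, integral_map hmeas.aemeasurable (by fun_prop), charFun_gaussianReal]
  have h : ∀ t : ι → ℝ, Complex.exp (s * ((∑ i, a i * t i : ℝ) : ℂ) * Complex.I) =
      ∏ i, Complex.exp (((s * a i : ℝ) : ℂ) * t i * Complex.I) := fun t => by
    rw [← Complex.exp_sum, ← Finset.sum_mul]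
    push_cast
    simp_rw [Finset.mul_sum, mul_assoc]
  simp_rw [h]
  rw [integral_fintype_prod_eq_prod
    (f := fun i x => Complex.exp (((s * a i : ℝ) : ℂ) * (x : ℝ) * Complex.I))]
  simp_rw [← charFun_apply_real, charFun_gaussianReal]
  rw [← Complex.exp_sum]
  have hnn : 0 ≤ ∑ i, a i ^ 2 := Finset.sum_nonneg fun i _ => sq_nonneg _
  rw [NNReal.coe_mul, Real.coe_toNNReal _ hnn]
  push_cast
  rw [Finset.sum_sub_distrib, Finset.mul_sum, Finset.sum_mul, Finset.sum_mul, Finset.sum_mul,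
    Finset.sum_div]
  congr 2 <;> exact Finset.sum_congr rfl fun i _ => by ring

lemma map_add_withDensity_prod {α β : Type*} [MeasurableSpace α] [MeasurableSpace β]
    {μ : Measure α} {ν : Measure β} [SFinite ν]
    {p : α → ℝ≥0∞} {q : α → β → ℝ≥0∞} {A : α → ℝ} {B : α → β → ℝ}
    (hp : Measurable p) (hq : Measurable (Function.uncurry q))
    (hA : Measurable A) (hB : Measurable (Function.uncurry B))
    {γ₁ γ₂ : Measure ℝ} [SFinite γ₂] (h₁ : (μ.withDensity p).map A = γ₁)
    (h₂ : ∀ x, (ν.withDensity (q x)).map (B x) = γ₂) :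
    ((μ.prod ν).withDensity fun z => p z.1 * q z.1 z.2).map (fun z => A z.1 + B z.1 z.2) =
      γ₁.conv γ₂ := by
  have hq' : Measurable fun z : α × β => q z.1 z.2 := hq
  have hB' : Measurable fun z : α × β => B z.1 z.2 := hB
  refine Measure.ext_of_lintegral _ fun f hf => ?_
  have hconv : Measurable fun x => ∫⁻ y, f (x + y) ∂γ₂ :=
    Measurable.lintegral_prod_right' (f := fun z : ℝ × ℝ => f (z.1 + z.2)) (by fun_prop)
  have hconvA : Measurable fun x => ∫⁻ y, f (A x + y) ∂γ₂ := hconv.comp hA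
  rw [lintegral_map hf (by fun_prop),
    lintegral_withDensity_eq_lintegral_mul _ (by fun_prop) (by fun_prop),
    lintegral_prod _ (by fun_prop), Measure.lintegral_conv hf, ← h₁, lintegral_map hconv hA,
    lintegral_withDensity_eq_lintegral_mul _ hp hconvA]
  refine lintegral_congr fun x => ?_
  have hqx : Measurable (q x) := hq.of_uncurry_left
  have hBx : Measurable (B x) := hB.of_uncurry_left
  simp only [Pi.mul_apply, mul_assoc]
  rw [lintegral_const_mul _ (by fun_prop), ← h₂ x, lintegral_map (by fun_prop) hBx,
    lintegral_withDensity_eq_lintegral_mul _ hqx (by fun_prop)]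
  rfl

lemma prod_gaussianPDFReal_eq {d : ℕ} {σ : ℝ} (hσ : 0 < σ) (μ t : Fin d → ℝ) :
    ∏ i, gaussianPDFReal (μ i) (Real.toNNReal (σ ^ 2)) (t i) =
      (2 * Real.pi * σ ^ 2) ^ (-(d : ℝ) / 2) *
        Real.exp (-(∑ i, (t i - μ i) ^ 2) / (2 * σ ^ 2)) := by
  have hpos : 0 < 2 * Real.pi * σ ^ 2 := by positivity
  simp only [gaussianPDFReal, Real.coe_toNNReal _ (sq_nonneg σ)]
  rw [Finset.prod_mul_distrib, Finset.prod_const, Finset.card_univ, Fintype.card_fin,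
    ← Real.exp_sum, ← Finset.sum_div, Finset.sum_neg_distrib, Real.sqrt_eq_rpow,
    ← Real.rpow_neg hpos.le, ← Real.rpow_natCast, ← Real.rpow_mul hpos.le]
  congr 2
  ring

/-- The privacy loss distribution of a single Gaussian mechanism with unit-norm shift `g`. -/
lemma map_privacyLoss_gaussian {d : ℕ} {σ : ℝ} (hσ : 0 < σ) (μ g : Fin d → ℝ)
    (hg : ∑ i, g i ^ 2 = 1) :
    ((volume : Measure (Fin d → ℝ)).withDensity fun t => ENNReal.ofReal
        ((2 * Real.pi * σ ^ 2) ^ (-(d : ℝ) / 2) *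
          Real.exp (-(∑ i, (t i - (μ + g) i) ^ 2) / (2 * σ ^ 2)))).map
        (fun t => (∑ i, (t i - μ i) ^ 2 - ∑ i, (t i - (μ + g) i) ^ 2) / (2 * σ ^ 2)) =
      gaussianReal (1 / (2 * σ ^ 2)) (Real.toNNReal (1 / σ ^ 2)) := by
  have hσ2 : 0 < σ ^ 2 := by positivity
  simp_rw [← prod_gaussianPDFReal_eq hσ]
  rw [← pi_gaussianReal_eq_withDensity _ (Real.toNNReal_pos.2 hσ2).ne']
  have hloss : (fun t : Fin d → ℝ =>
      (∑ i, (t i - μ i) ^ 2 - ∑ i, (t i - (μ + g) i) ^ 2) / (2 * σ ^ 2)) =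
      (fun x => x + -(2 * ∑ i, g i * μ i + 1) / (2 * σ ^ 2)) ∘
        fun t => ∑ i, g i / σ ^ 2 * t i := by
    funext t
    have h : ∑ i, (t i - μ i) ^ 2 - ∑ i, (t i - (μ + g) i) ^ 2 =
        2 * ∑ i, g i * t i - 2 * ∑ i, g i * μ i - ∑ i, g i ^ 2 := by
      simp only [Finset.mul_sum, ← Finset.sum_sub_distrib, Pi.add_apply]
      exact Finset.sum_congr rfl fun i _ => by ring
    simp only [Function.comp_apply, div_mul_eq_mul_div, ← Finset.sum_div]
    rw [h, hg]
    field_simp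
    ring
  rw [hloss, ← Measure.map_map (by fun_prop) (by fun_prop), map_sum_mul_pi_gaussianReal,
    gaussianReal_map_add_const]
  congr 1
  · simp only [Pi.add_apply, mul_add, Finset.sum_add_distrib, div_mul_eq_mul_div,
      ← Finset.sum_div, ← sq, hg]
    field_simp
    ring
  · simp only [div_pow, ← Finset.sum_div, hg]
    rw [← Real.toNNReal_mul (by positivity)]
    congr 1
    field_simp

/-- Appendix theorem (k = 2 case): the privacy loss distribution of a two-step
adaptive composition of d-dimensional Gaussian mechanisms with unit-norm
sensitivity directions equals that of the two-fold non-adaptive composition of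
one-dimensional Gaussian mechanisms with sensitivity 1, namely
`N(1/σ², 2/σ²)`. -/
theorem adaptive_gaussian_pld_two_steps
    (d : ℕ) (hd : 1 ≤ d) (σ : ℝ) (hσ : 0 < σ)
    (v g₁ : Fin d → ℝ) (hg₁ : ∑ i, (g₁ i) ^ 2 = 1)
    (m g₂ : (Fin d → ℝ) → (Fin d → ℝ))
    (hm : Measurable m) (hg₂ : Measurable g₂)
    (hg₂n : ∀ t, ∑ i, (g₂ t i) ^ 2 = 1) :
    -- density of the Gaussian N(μ, σ²I_d) on ℝ^d
    let φ : (Fin d → ℝ) → (Fin d → ℝ) → ℝ := fun μ t =>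
      (2 * Real.pi * σ ^ 2) ^ (-(d : ℝ) / 2) *
        Real.exp (-(∑ i, (t i - μ i) ^ 2) / (2 * σ ^ 2))
    -- density of the two-step adaptive mechanism on X
    let fX : (Fin d → ℝ) × (Fin d → ℝ) → ℝ := fun t => φ v t.1 * φ (m t.1) t.2
    -- density of the two-step adaptive mechanism on the neighbouring X'
    let fX' : (Fin d → ℝ) × (Fin d → ℝ) → ℝ := fun t =>
      φ (v + g₁) t.1 * φ (m t.1 + g₂ t.1) t.2
    -- privacy loss function
    let Lfun : (Fin d → ℝ) × (Fin d → ℝ) → ℝ := fun t => Real.log (fX' t / fX t)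
    Measure.map Lfun (volume.withDensity fun t => ENNReal.ofReal (fX' t)) =
      gaussianReal (1 / σ ^ 2) (Real.toNNReal (2 / σ ^ 2)) := by
  intro φ fX fX' Lfun
  have hc : 0 < (2 * Real.pi * σ ^ 2) ^ (-(d : ℝ) / 2) := by positivity
  have hφ : ∀ μ t, 0 < φ μ t := fun μ t => mul_pos hc (Real.exp_pos _)
  have hlog : ∀ μ μ' t, Real.log (φ μ' t / φ μ t) =
      (∑ i, (t i - μ i) ^ 2 - ∑ i, (t i - μ' i) ^ 2) / (2 * σ ^ 2) := fun μ μ' t => by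
    simp only [φ]
    rw [mul_div_mul_left _ _ hc.ne', ← Real.exp_sub, Real.log_exp]
    ring
  have hL : Lfun = fun t => Real.log (φ (v + g₁) t.1 / φ v t.1) +
      Real.log (φ (m t.1 + g₂ t.1) t.2 / φ (m t.1) t.2) := by
    funext t
    simp only [Lfun, fX, fX']
    rw [← Real.log_mul (div_pos (hφ _ _) (hφ _ _)).ne' (div_pos (hφ _ _) (hφ _ _)).ne',
      div_mul_div_comm]
  have hφm : Measurable (Function.uncurry φ) := by
    simp only [φ, Function.uncurry_def]
    fun_prop
  have hφ_def : ∀ μ t, φ μ t = (2 * Real.pi * σ ^ 2) ^ (-(d : ℝ) / 2) *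
      Real.exp (-(∑ i, (t i - μ i) ^ 2) / (2 * σ ^ 2)) := fun _ _ => rfl
  clear_value φ
  have hφc {α : Type} [MeasurableSpace α] {f h : α → Fin d → ℝ} (hf : Measurable f)
      (hh : Measurable h) : Measurable fun x => φ (f x) (h x) := hφm.comp (hf.prodMk hh)
  have hdens : (fun t => ENNReal.ofReal (fX' t)) = fun t : (Fin d → ℝ) × (Fin d → ℝ) =>
      ENNReal.ofReal (φ (v + g₁) t.1) * ENNReal.ofReal (φ (m t.1 + g₂ t.1) t.2) :=
    funext fun t => ENNReal.ofReal_mul (hφ _ _).le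
  rw [hL, hdens, Measure.volume_eq_prod]
  rw [map_add_withDensity_prod (p := fun t => ENNReal.ofReal (φ (v + g₁) t))
    (q := fun s t => ENNReal.ofReal (φ (m s + g₂ s) t))
    (A := fun t => Real.log (φ (v + g₁) t / φ v t))
    (B := fun s t => Real.log (φ (m s + g₂ s) t / φ (m s) t))
    (γ₁ := gaussianReal (1 / (2 * σ ^ 2)) (Real.toNNReal (1 / σ ^ 2)))
    (γ₂ := gaussianReal (1 / (2 * σ ^ 2)) (Real.toNNReal (1 / σ ^ 2)))]
  · rw [gaussianReal_conv_gaussianReal, ← Real.toNNReal_add (by positivity) (by positivity)]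
    congr 2 <;> ring
  · exact (hφc (by fun_prop) (by fun_prop)).ennreal_ofReal
  · exact (hφc (by fun_prop) (by fun_prop)).ennreal_ofReal
  · exact ((hφc (by fun_prop) (by fun_prop)).div (hφc (by fun_prop) (by fun_prop))).log
  · exact ((hφc (by fun_prop) (by fun_prop)).div (hφc (by fun_prop) (by fun_prop))).log
  · simp_rw [hlog, hφ_def]
    exact map_privacyLoss_gaussian hσ v g₁ hg₁
  · intro s
    simp_rw [hlog, hφ_def]
    exact map_privacyLoss_gaussian hσ (m s) (g₂ s) (hg₂n s)
end

section
/- Let σ > 0 and let φ_{μ,σ²}(t) = (2πσ²)^{−1/2} exp(−(t−μ)²/(2σ²)) denote the density of the one-dimensional Gaussian gaussianReal μ σ². Then for every c with 0 ≤ c ≤ 1 and every ε ∈ ℝ, ∫_ℝ max( φ_{c,σ²}(t) − e^ε φ_{0,σ²}(t), 0 ) dt ≤ ∫_ℝ max( φ_{1,σ²}(t) − e^ε φ_{0,σ²}(t), 0 ) dt. Equivalently, the hockey-stick divergence H_ε(N(c,σ²) ‖ N(0,σ²)) is at most H_ε(N(1,σ²) ‖ N(0,σ²)), so analysing the Gaussian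 mechanism with sensitivity exactly 1 upper-bounds the δ(ε) for sensitivities c ≤ 1. -/
open MeasureTheory

/-- Translating a nonnegative density to the left decreases the mass of an upper set. -/
theorem setIntegral_comp_add_right_le_of_isUpperSet {f : ℝ → ℝ} (hf : Integrable f)
    (hf0 : 0 ≤ f) {s : Set ℝ} (hs : IsUpperSet s) (hsm : MeasurableSet s) {h : ℝ} (hh : 0 ≤ h) :
    ∫ t in s, f (t + h) ≤ ∫ t in s, f t := by
  rw [← integral_indicator hsm, ← integral_indicator hsm,
    ← integral_add_right_eq_self (s.indicator f) h]
  refine integral_mono ((hf.comp_add_right h).indicator hsm)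
    ((hf.indicator hsm).comp_add_right h) fun t => ?_
  by_cases ht : t ∈ s
  · have hth : t + h ∈ s := hs (le_add_of_nonneg_right hh) ht
    simp [ht, hth]
  · simpa [ht] using Set.indicator_nonneg (fun x _ => hf0 x) (t + h)

/-- The integral of the positive part is the integral over the positivity set. -/
theorem integral_max_zero_eq_setIntegral {f : ℝ → ℝ} (hf : Measurable f) :
    ∫ t, max (f t) 0 = ∫ t in {t | 0 < f t}, f t := by
  rw [← integral_indicator (measurableSet_lt measurable_const hf)]
  refine integral_congr_ae (.of_forall fun t => ?_)
  by_cases ht : 0 < f t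
  · simp [ht, ht.le]
  · simp [ht, not_lt.mp ht]

theorem setIntegral_le_integral_max_zero {f : ℝ → ℝ} (hf : Integrable f) (s : Set ℝ) :
    ∫ t in s, f t ≤ ∫ t, max (f t) 0 :=
  (setIntegral_mono hf.integrableOn hf.pos_part.integrableOn fun _ => le_max_left _ _).trans
    (setIntegral_le_integral hf.pos_part (.of_forall fun _ => le_max_right _ _))

/-- The hockey-stick divergence from a fixed density `g` does not decrease when `f` is translated
to the right, provided the optimal test set for `f` is an upper set. -/
theorem integral_max_sub_comp_add_right_le {f g : ℝ → ℝ} (hf : Integrable f) (hf0 : 0 ≤ f)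
    (hfm : Measurable f) (hg : Integrable g) (hgm : Measurable g) {h : ℝ} (hh : 0 ≤ h)
    (hs : IsUpperSet {t | 0 < f (t + h) - g t}) :
    ∫ t, max (f (t + h) - g t) 0 ≤ ∫ t, max (f t - g t) 0 := by
  have hm : Measurable fun t => f (t + h) - g t := by fun_prop
  have hsm : MeasurableSet {t | 0 < f (t + h) - g t} := measurableSet_lt measurable_const hm
  rw [integral_max_zero_eq_setIntegral hm]
  refine le_trans ?_ (setIntegral_le_integral_max_zero (hf.sub hg) {t | 0 < f (t + h) - g t})
  simp only [Pi.sub_apply]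
  rw [integral_sub (hf.comp_add_right h).integrableOn hg.integrableOn,
    integral_sub hf.integrableOn hg.integrableOn]
  exact sub_le_sub_right (setIntegral_comp_add_right_le_of_isUpperSet hf hf0 hs hsm hh) _

/-- Gaussian densities with nonnegative mean have monotone likelihood ratio against the centred
one. -/
theorem isUpperSet_gaussian_likelihood_ratio {A σ c : ℝ} (hA : 0 < A) (hc : 0 ≤ c) (K : ℝ) :
    IsUpperSet {t : ℝ | 0 < A * Real.exp (-(t - c) ^ 2 / (2 * σ ^ 2)) -
      K * (A * Real.exp (-(t - 0) ^ 2 / (2 * σ ^ 2)))} := by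
  have key (t : ℝ) : A * Real.exp (-(t - c) ^ 2 / (2 * σ ^ 2)) -
      K * (A * Real.exp (-(t - 0) ^ 2 / (2 * σ ^ 2))) =
      A * Real.exp (-(t - 0) ^ 2 / (2 * σ ^ 2)) *
        (Real.exp ((2 * t * c - c ^ 2) / (2 * σ ^ 2)) - K) := by
    have : -(t - c) ^ 2 / (2 * σ ^ 2) =
        -(t - 0) ^ 2 / (2 * σ ^ 2) + (2 * t * c - c ^ 2) / (2 * σ ^ 2) := by ring
    rw [this, Real.exp_add]
    ring
  intro a b hab ha
  simp only [Set.mem_ofPred_eq, key] at ha ⊢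
  refine mul_pos (by positivity) ((pos_of_mul_pos_right ha (by positivity)).trans_le ?_)
  gcongr

/-- Monotonicity of the hockey-stick divergence with respect to the
sensitivity: for `0 ≤ c ≤ 1`, `H_ε(N(c,σ²)‖N(0,σ²)) ≤ H_ε(N(1,σ²)‖N(0,σ²))`. -/
theorem hockey_stick_monotone_in_sensitivity
    (σ : ℝ) (hσ : 0 < σ) (c : ℝ) (hc : c ∈ Set.Icc (0 : ℝ) 1) (ε : ℝ) :
    let φ : ℝ → ℝ → ℝ := fun μ t =>
      (2 * Real.pi * σ ^ 2) ^ (-(1 : ℝ) / 2) *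
        Real.exp (-(t - μ) ^ 2 / (2 * σ ^ 2))
    ∫ t : ℝ, max (φ c t - Real.exp ε * φ 0 t) 0 ≤
      ∫ t : ℝ, max (φ 1 t - Real.exp ε * φ 0 t) 0 := by
  intro φ
  have hint (μ : ℝ) : Integrable (φ μ) := by
    have h := (integrable_exp_neg_mul_sq (b := 1 / (2 * σ ^ 2)) (by positivity)).comp_sub_right μ
    refine (h.congr (.of_forall fun t => ?_)).const_mul _
    simp only
    congr 1
    ring
  have hmeas (μ : ℝ) : Measurable (φ μ) := by fun_prop
  have hshift (t : ℝ) : φ c t = φ 1 (t + (1 - c)) := by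
    simp only [φ]
    ring_nf
  have hupper : IsUpperSet {t | 0 < φ c t - Real.exp ε * φ 0 t} :=
    isUpperSet_gaussian_likelihood_ratio (by positivity) hc.1 _
  simp only [hshift] at hupper ⊢
  exact integral_max_sub_comp_add_right_le (hint 1) (fun t => by positivity) (hmeas 1)
    ((hint 0).const_mul _) ((hmeas 0).const_mul _) (sub_nonneg.mpr hc.2) hupper
end

section
/- Let p₁, q₁ be probability mass functions on a finite type R₁ and p₂, q₂ probability mass functions on a finite type R₂, and assume q₁(t) > 0 whenever p₁(t) > 0 and q₂(t) > 0 whenever p₂(t) > 0. Let ω₁ be the distribution on ℝ of log(p₁(T₁)/q₁(T₁)) when T₁ ∼ p₁, and ω₂ the distribution of log(p₂(T₂)/q₂(T₂)) when T₂ ∼ p₂. Then the distribution on ℝ of log( (p₁(T₁)p₂(T₂)) / (q₁(T₁)q₂(T₂)) ), where (T₁, T₂) ∼ p₁ ⊗ p₂ are independent, equals the convolution ω₁ ∗ ω₂ (the distribution of the sum of independent draws from ω₁ and ω₂). That is, the privacy loss distribution of a non-adaptive composition of two independent discrete mechanisms is the convolution of their privacy loss distributions. -/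
open MeasureTheory Finset

/-- The product of two finite weighted sums of Dirac measures. -/
theorem MeasureTheory.Measure.prod_sum_smul_dirac {α β : Type*} [Fintype α] [Fintype β]
    [MeasurableSpace α] [MeasurableSpace β] [MeasurableSingletonClass α]
    [MeasurableSingletonClass β] (a : α → ℝ) (b : β → ℝ) (ha : ∀ x, 0 ≤ a x) :
    (∑ x, ENNReal.ofReal (a x) • Measure.dirac x).prod
        (∑ y, ENNReal.ofReal (b y) • Measure.dirac y) =
      ∑ z : α × β, ENNReal.ofReal (a z.1 * b z.2) • Measure.dirac z := by
  classical
  have hβ : IsFiniteMeasure (∑ y, ENNReal.ofReal (b y) • Measure.dirac y) :=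
    ⟨by simp [ENNReal.sum_lt_top]⟩
  refine Measure.ext_of_singleton fun z => ?_
  rw [← Prod.mk.eta (p := z), ← Set.singleton_prod_singleton, Measure.prod_prod]
  simp [Set.indicator_apply, ENNReal.ofReal_mul (ha _)]

/-- The pushforward of a finite weighted sum of Dirac measures. -/
theorem MeasureTheory.Measure.map_sum_smul_dirac {α β : Type*} [Fintype α]
    [MeasurableSpace α] [MeasurableSpace β] {f : α → β} (hf : Measurable f)
    (c : α → ENNReal) :
    Measure.map f (∑ x, c x • Measure.dirac x) = ∑ x, c x • Measure.dirac (f x) := by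
  ext s hs
  simp [Measure.map_apply hf hs, Measure.dirac_apply' _ hs, Measure.dirac_apply' _ (hf hs),
    ← Set.indicator_comp_right]

/-- Key identity in the proof of Theorem 4: the privacy loss distribution of a
non-adaptive composition of two independent discrete mechanisms is the
convolution (law of the sum of independent draws) of the individual privacy
loss distributions. -/
theorem pld_of_composition_is_convolution
    {R₁ R₂ : Type*} [Fintype R₁] [Fintype R₂] [MeasurableSpace R₁]
    [MeasurableSpace R₂] [MeasurableSingletonClass R₁] [MeasurableSingletonClass R₂]
    (p₁ q₁ : R₁ → ℝ) (p₂ q₂ : R₂ → ℝ)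
    (hp₁0 : ∀ t, 0 ≤ p₁ t) (hq₁0 : ∀ t, 0 ≤ q₁ t)
    (hp₂0 : ∀ t, 0 ≤ p₂ t) (hq₂0 : ∀ t, 0 ≤ q₂ t)
    (hp₁1 : ∑ t, p₁ t = 1) (hq₁1 : ∑ t, q₁ t = 1)
    (hp₂1 : ∑ t, p₂ t = 1) (hq₂1 : ∑ t, q₂ t = 1)
    (hsupp₁ : ∀ t, 0 < p₁ t → 0 < q₁ t)
    (hsupp₂ : ∀ t, 0 < p₂ t → 0 < q₂ t) :
    -- discrete measures associated with p₁, p₂ and their product p₁ ⊗ p₂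
    let P₁ : Measure R₁ := ∑ t : R₁, ENNReal.ofReal (p₁ t) • Measure.dirac t
    let P₂ : Measure R₂ := ∑ t : R₂, ENNReal.ofReal (p₂ t) • Measure.dirac t
    let P₁₂ : Measure (R₁ × R₂) := ∑ t : R₁ × R₂,
      ENNReal.ofReal (p₁ t.1 * p₂ t.2) • Measure.dirac t
    -- privacy loss distributions: laws of log(p(T)/q(T)) with T ∼ p
    let ω₁ : Measure ℝ := Measure.map (fun t => Real.log (p₁ t / q₁ t)) P₁
    let ω₂ : Measure ℝ := Measure.map (fun t => Real.log (p₂ t / q₂ t)) P₂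
    -- the privacy loss distribution of the composition ...
    Measure.map (fun t : R₁ × R₂ =>
        Real.log ((p₁ t.1 * p₂ t.2) / (q₁ t.1 * q₂ t.2))) P₁₂ =
      -- ... equals the convolution ω₁ ∗ ω₂
      Measure.map (fun s : ℝ × ℝ => s.1 + s.2) (ω₁.prod ω₂) := by
  intro P₁ P₂ P₁₂ ω₁ ω₂
  have hP₁ : IsFiniteMeasure P₁ := ⟨by simp [P₁, ENNReal.sum_lt_top]⟩
  have hP₂ : IsFiniteMeasure P₂ := ⟨by simp [P₂, ENNReal.sum_lt_top]⟩
  rw [Measure.map_prod_map P₁ P₂ .of_discrete .of_discrete,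
    Measure.map_map (by fun_prop) .of_discrete, Measure.prod_sum_smul_dirac _ _ hp₁0,
    Measure.map_sum_smul_dirac .of_discrete, Measure.map_sum_smul_dirac .of_discrete]
  refine Finset.sum_congr rfl fun t _ => ?_
  rcases (hp₁0 t.1).eq_or_lt with h₁ | h₁
  · simp [← h₁]
  rcases (hp₂0 t.2).eq_or_lt with h₂ | h₂
  · simp [← h₂]
  have hlog : Real.log (p₁ t.1 * p₂ t.2 / (q₁ t.1 * q₂ t.2)) =
      Real.log (p₁ t.1 / q₁ t.1) + Real.log (p₂ t.2 / q₂ t.2) := by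
    rw [mul_div_mul_comm, Real.log_mul (div_pos h₁ (hsupp₁ _ h₁)).ne'
      (div_pos h₂ (hsupp₂ _ h₂)).ne']
  simp [hlog]
end
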